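/- Let φ be a semiflow on E satisfying (H1), (H2) with j = 2, (H3), (COM) and (S). Then for every w₀ ∈ E whose positive semi-orbit γ⁺(w₀) is bounded in E, the ω-limit set ω(w₀) is one of the following: (T1) a single stationary point; (T2) a periodic orbit; (T3) a union of a nonempty set N of stationary points and a set of orbits {v(t) : t ∈ ℝ} of complete trajectories v whose α-limit sets and ω-limit sets are contained in N. -/

import Mathlib

open Set Filter Topology MeasureTheory Bornology

/-- A semiflow on a Banach space `E`. -/
structure Semiflow (E : Type*) [NormedAddCommGroup E] [NormedSpace ℝ E] where
  toFun : ℝ → E → E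
  map_zero' : ∀ v : E, toFun 0 v = v
  map_add' : ∀ t s : ℝ, 0 ≤ t → 0 ≤ s → ∀ v : E, toFun (t + s) v = toFun t (toFun s v)
  continuousOn' : ContinuousOn (fun p : ℝ × E => toFun p.1 p.2) (Set.Ici (0 : ℝ) ×ˢ Set.univ)

/-- The open `r`-neighborhood `O_r(γ)` of a set `γ` in a normed space. -/
def setNbhd {E : Type*} [NormedAddCommGroup E] (γ : Set E) (r : ℝ) : Set E :=
  {v | ∃ w ∈ γ, ‖v - w‖ < r}

/-- `S` is an `ε`-section at `x₀` of the (partial) flow `ξ` on the set `M`. -/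
def IsSectionOn {X : Type*} [TopologicalSpace X] (M : Set X) (ξ : ℝ → X → X)
    (ε : ℝ) (x₀ : X) (S : Set X) : Prop :=
  x₀ ∈ S ∧ S ⊆ M ∧
    (∃ W : Set X, IsOpen W ∧ x₀ ∈ W ∧
      W ∩ M ⊆ ⋃ t ∈ Set.Icc (-ε) ε, ξ t '' S) ∧
    ∀ y ∈ ⋃ t ∈ Set.Icc (-ε) ε, ξ t '' S,
      ∃! p : ℝ × X, p.1 ∈ Set.Icc (-ε) ε ∧ p.2 ∈ S ∧ ξ p.1 p.2 = y

/-- `T` is an `ε`-transversal at `x₀` of the (partial) flow `ξ` on the set `M`: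
an `ε`-section which is the image of a topological embedding of `[-1,1]`,
with `x₀` corresponding to an interior point. -/
def IsTransversalOn {X : Type*} [TopologicalSpace X] (M : Set X) (ξ : ℝ → X → X)
    (ε : ℝ) (x₀ : X) (T : Set X) : Prop :=
  IsSectionOn M ξ ε x₀ T ∧
    ∃ h : ℝ → X, ContinuousOn h (Set.Icc (-1 : ℝ) 1) ∧ Set.InjOn h (Set.Icc (-1 : ℝ) 1) ∧
      h '' Set.Icc (-1 : ℝ) 1 = T ∧ ∃ s₀ ∈ Set.Ioo (-1 : ℝ) 1, h s₀ = x₀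

namespace Semiflow

variable {E : Type*} [NormedAddCommGroup E] [NormedSpace ℝ E]
variable {H : Type*} [NormedAddCommGroup H] [InnerProductSpace ℝ H]

/-- A stationary point of the semiflow. -/
def IsStationary (φ : Semiflow E) (v₀ : E) : Prop :=
  ∀ t : ℝ, 0 ≤ t → φ.toFun t v₀ = v₀

/-- A periodic (non-stationary) point of the semiflow. -/
def IsPeriodicPt (φ : Semiflow E) (v₀ : E) : Prop :=
  ¬ φ.IsStationary v₀ ∧ ∃ σ : ℝ, 0 < σ ∧ φ.toFun σ v₀ = v₀

/-- The positive semi-orbit `γ⁺(v₀)` (which equals the full orbit for periodic points). -/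
def orbit (φ : Semiflow E) (v₀ : E) : Set E :=
  {w | ∃ t : ℝ, 0 ≤ t ∧ φ.toFun t v₀ = w}

/-- `γ` is a periodic orbit of the semiflow. -/
def IsPeriodicOrbit (φ : Semiflow E) (γ : Set E) : Prop :=
  ∃ v₀ : E, φ.IsPeriodicPt v₀ ∧ γ = φ.orbit v₀

/-- The ω-limit set of a point. -/
def omegaLimit (φ : Semiflow E) (v₀ : E) : Set E :=
  ⋂ s ∈ Set.Ici (0 : ℝ), closure {w | ∃ t : ℝ, s ≤ t ∧ φ.toFun t v₀ = w}

/-- A complete trajectory of the semiflow. -/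
def IsCompleteTrajectory (φ : Semiflow E) (v : ℝ → E) : Prop :=
  Continuous v ∧ ∀ t : ℝ, 0 ≤ t → ∀ s : ℝ, v (t + s) = φ.toFun t (v s)

/-- The α-limit set of a complete trajectory. -/
def alphaLimitOf (φ : Semiflow E) (v : ℝ → E) : Set E :=
  ⋂ s ∈ Set.Iic (0 : ℝ), closure {w | ∃ t : ℝ, t ≤ s ∧ v t = w}

/-- Hypothesis (H1): `P` is symmetric and positive on `Eplus`, negative on `Eminus`,
with `E = Eplus ⊕ Eminus`. -/
def IsH1 (P : E →L[ℝ] E →L[ℝ] ℝ) (Eplus Eminus : Submodule ℝ E) : Prop :=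
  (∀ v w : E, P v w = P w v) ∧ IsClosed (Eplus : Set E) ∧ IsClosed (Eminus : Set E) ∧
    IsCompl Eplus Eminus ∧
    (∀ v ∈ Eplus, v ≠ 0 → 0 < P v v) ∧ (∀ v ∈ Eminus, v ≠ 0 → P v v < 0)

/-- Hypothesis (H3): squeezing with respect to `V(v) = ⟨v, Pv⟩`, with parameters
`δ > 0`, `τV ≥ 0`, `ν > 0`; the embedding `E ↪ H` is `ι`. -/
def IsH3 (φ : Semiflow E) (ι : E →L[ℝ] H) (P : E →L[ℝ] E →L[ℝ] ℝ) (δ τV ν : ℝ) : Prop :=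
  0 < δ ∧ 0 ≤ τV ∧ 0 < ν ∧
    ∀ v₁ v₂ : E, ∀ l r : ℝ, 0 ≤ l → l ≤ r → τV ≤ r - l →
      Real.exp (2 * ν * r) *
          P (φ.toFun r v₁ - φ.toFun r v₂) (φ.toFun r v₁ - φ.toFun r v₂) -
        Real.exp (2 * ν * l) *
          P (φ.toFun l v₁ - φ.toFun l v₂) (φ.toFun l v₁ - φ.toFun l v₂) ≤
      -δ * ∫ s in l..r, Real.exp (2 * ν * s) * ‖ι (φ.toFun s v₁) - ι (φ.toFun s v₂)‖ ^ 2

/-- Hypothesis (COM): some time-`τ` map takes bounded sets to precompact sets. -/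
def IsCOM (φ : Semiflow E) : Prop :=
  ∃ τ : ℝ, 0 < τ ∧ ∀ B : Set E, IsBounded B → IsCompact (closure (φ.toFun τ '' B))

/-- Hypothesis (S): a smoothing estimate from `H` to `E`. -/
def IsSmoothing (φ : Semiflow E) (ι : E →L[ℝ] H) : Prop :=
  ∃ τ C : ℝ, 0 ≤ τ ∧ 0 < C ∧
    ∀ v₁ v₂ : E, ‖φ.toFun τ v₁ - φ.toFun τ v₂‖ ≤ C * ‖ι v₁ - ι v₂‖

/-- An amenable trajectory: a complete trajectory with
`∫_{-∞}^0 e^{2νs} |v(s)|²_H ds < ∞`. -/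
def IsAmenableTrajectory (φ : Semiflow E) (ι : E →L[ℝ] H) (ν : ℝ) (v : ℝ → E) : Prop :=
  φ.IsCompleteTrajectory v ∧
    IntegrableOn (fun s : ℝ => Real.exp (2 * ν * s) * ‖ι (v s)‖ ^ 2) (Set.Iic (0 : ℝ))

/-- The amenable set `𝔄`: points through which an amenable trajectory passes. -/
def amenableSet (φ : Semiflow E) (ι : E →L[ℝ] H) (ν : ℝ) : Set E :=
  {v₀ | ∃ v : ℝ → E, φ.IsAmenableTrajectory ι ν v ∧ v 0 = v₀}

/-- Orbital stability of a set `γ`. -/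
def IsOrbitallyStable (φ : Semiflow E) (γ : Set E) : Prop :=
  ∀ ε : ℝ, 0 < ε → ∃ δ : ℝ, 0 < δ ∧
    ∀ v ∈ setNbhd γ δ, ∀ t : ℝ, 0 ≤ t → φ.toFun t v ∈ setNbhd γ ε

/-- Amenable stability: orbital stability with respect to initial data in `𝔄`. -/
def IsAmenableStable (φ : Semiflow E) (ι : E →L[ℝ] H) (ν : ℝ) (γ : Set E) : Prop :=
  ∀ ε : ℝ, 0 < ε → ∃ δ : ℝ, 0 < δ ∧
    ∀ v ∈ setNbhd γ δ ∩ φ.amenableSet ι ν, ∀ t : ℝ, 0 ≤ t → φ.toFun t v ∈ setNbhd γ ε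

/-- Lyapunov stability of a stationary point. -/
def IsLyapunovStable (φ : Semiflow E) (v₀ : E) : Prop :=
  ∀ ε : ℝ, 0 < ε → ∃ δ : ℝ, 0 < δ ∧
    ∀ v : E, ‖v - v₀‖ < δ → ∀ t : ℝ, 0 ≤ t → ‖φ.toFun t v - v₀‖ < ε

/-- `D` is a `k`-dimensional local unstable set for the stationary point `v₀`:
(U1) `D` is a homeomorphic image of an open `k`-cube; (U2) through every point of `D`
there is a unique complete trajectory, converging to `v₀` as `t → -∞`;
(U3) trajectories through points of `D` near `v₀` stay near `v₀` for `t ≤ 0`. -/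
def IsLocalUnstableSet (φ : Semiflow E) (k : ℕ) (v₀ : E) (D : Set E) : Prop :=
  v₀ ∈ D ∧
    Nonempty (↥(Set.pi Set.univ fun _ : Fin k => Set.Ioo (0 : ℝ) 1) ≃ₜ ↥D) ∧
    (∀ w₀ ∈ D, ∃! w : ℝ → E, φ.IsCompleteTrajectory w ∧ w 0 = w₀) ∧
    (∀ w₀ ∈ D, ∀ w : ℝ → E, φ.IsCompleteTrajectory w → w 0 = w₀ →
      Filter.Tendsto w Filter.atBot (nhds v₀)) ∧
    (∀ ε : ℝ, 0 < ε → ∃ δ : ℝ, 0 < δ ∧ ∀ w₀ ∈ D, ‖w₀ - v₀‖ < δ →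
      ∀ w : ℝ → E, φ.IsCompleteTrajectory w → w 0 = w₀ → ∀ t : ℝ, t ≤ 0 → ‖w t - v₀‖ < ε)

/-- An unstable terminal point: a stationary point with a 2-dimensional local unstable set. -/
def IsUnstableTerminal (φ : Semiflow E) (v₀ : E) : Prop :=
  φ.IsStationary v₀ ∧ ∃ D : Set E, φ.IsLocalUnstableSet 2 v₀ D

/-- A terminal point: a stationary point that is Lyapunov stable or has a
2-dimensional local unstable set. -/
def IsTerminal (φ : Semiflow E) (v₀ : E) : Prop :=
  φ.IsStationary v₀ ∧
    (φ.IsLyapunovStable v₀ ∨ ∃ D : Set E, φ.IsLocalUnstableSet 2 v₀ D)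

/-- An attractor: a bounded closed set with an open neighborhood all of whose points have
precompact positive semi-orbits with ω-limit sets inside the set. -/
def IsAttractor (φ : Semiflow E) (A : Set E) : Prop :=
  IsBounded A ∧ IsClosed A ∧
    ∃ U : Set E, IsOpen U ∧ A ⊆ U ∧
      ∀ v₀ ∈ U, IsCompact (closure (φ.orbit v₀)) ∧ φ.omegaLimit v₀ ⊆ A

/-- `Pi` is the `V`-orthogonal projector onto `Eminus`. -/
def IsVProjector (P : E →L[ℝ] E →L[ℝ] ℝ) (Eminus : Submodule ℝ E) (Pi : E → E) : Prop :=
  ∀ v : E, Pi v ∈ Eminus ∧ ∀ w ∈ Eminus, P w v = P w (Pi v)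

/-- The interior region `𝒢_γ ⊆ 𝔄` of a periodic orbit `γ`: the preimage under `Π`
of the bounded connected component of `E⁻ \ Πγ`. -/
def interiorRegion (φ : Semiflow E) (ι : E →L[ℝ] H) (ν : ℝ) (Eminus : Submodule ℝ E)
    (Pi : E → E) (γ : Set E) : Set E :=
  {a | a ∈ φ.amenableSet ι ν ∧ Pi a ∈ (Eminus : Set E) \ (Pi '' γ) ∧
    IsBounded (connectedComponentIn ((Eminus : Set E) \ (Pi '' γ)) (Pi a))}

/-- The partial order `γ₁ ⩽ γ₂` on periodic orbits: `𝒢_{γ₁} ⊆ 𝒢_{γ₂}`. -/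
def orbitLE (φ : Semiflow E) (ι : E →L[ℝ] H) (ν : ℝ) (Eminus : Submodule ℝ E)
    (Pi : E → E) (γ₁ γ₂ : Set E) : Prop :=
  φ.interiorRegion ι ν Eminus Pi γ₁ ⊆ φ.interiorRegion ι ν Eminus Pi γ₂

/-- External stability of a periodic orbit `γ`. -/
def IsExternallyStable (φ : Semiflow E) (ι : E →L[ℝ] H) (ν : ℝ) (Eminus : Submodule ℝ E)
    (Pi : E → E) (γ : Set E) : Prop :=
  (∃ g : ℕ → Set E, (∀ k, φ.IsPeriodicOrbit (g k)) ∧ (∀ k, g k ≠ γ) ∧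
      (∀ k, φ.orbitLE ι ν Eminus Pi γ (g k)) ∧
      Filter.Tendsto (fun k => Metric.hausdorffDist (g k) γ) Filter.atTop (nhds 0)) ∨
    (∃ v₀ ∈ φ.amenableSet ι ν \ closure (φ.interiorRegion ι ν Eminus Pi γ),
      φ.omegaLimit v₀ = γ)

/-- Internal stability of a periodic orbit `γ`. -/
def IsInternallyStable (φ : Semiflow E) (ι : E →L[ℝ] H) (ν : ℝ) (Eminus : Submodule ℝ E)
    (Pi : E → E) (γ : Set E) : Prop :=
  (∃ g : ℕ → Set E, (∀ k, φ.IsPeriodicOrbit (g k)) ∧ (∀ k, g k ≠ γ) ∧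
      (∀ k, φ.orbitLE ι ν Eminus Pi (g k) γ) ∧
      Filter.Tendsto (fun k => Metric.hausdorffDist (g k) γ) Filter.atTop (nhds 0)) ∨
    (∃ v₀ ∈ φ.interiorRegion ι ν Eminus Pi γ, φ.omegaLimit v₀ = γ)

end Semiflow

open Set Filter Topology MeasureTheory Bornology

/-- integer constancy -/
lemma pb_angle_const {f : ℝ → ℝ} {a b : ℝ} (hab : a ≤ b) (hf : ContinuousOn f (Icc a b))
    (h0 : ∀ x ∈ Icc a b, (f x : Real.Angle) = 0) : f a = f b := by
  have hinteg : ∀ x ∈ Icc a b, ∃ n : ℤ, f x = n * (2 * Real.pi) := by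
    intro x hx
    have := h0 x hx
    rw [Real.Angle.coe_eq_zero_iff] at this
    obtain ⟨n, hn⟩ := this
    exact ⟨n, by rw [← hn]; simp⟩
  by_contra hne
  obtain ⟨n, hn⟩ := hinteg a ⟨le_rfl, hab⟩
  obtain ⟨m, hm⟩ := hinteg b ⟨hab, le_rfl⟩
  have hpi := Real.pi_pos
  have key : ∀ y, y ∈ uIcc (f a) (f b) → ∃ k : ℤ, y = k * (2 * Real.pi) := by
    intro y hy
    have := intermediate_value_uIcc (f := f) (a := a) (b := b) (by rwa [uIcc_of_le hab])
    obtain ⟨x, hx, rfl⟩ := this hy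
    rw [uIcc_of_le hab] at hx
    exact hinteg x hx
  rcases lt_or_gt_of_ne hne with h | h
  · have hnm : n < m := by
      rw [hn, hm] at h
      have := lt_of_mul_lt_mul_right h (by positivity)
      exact_mod_cast this
    have hnm' : (n : ℝ) + 1 ≤ m := by exact_mod_cast hnm
    obtain ⟨k, hk⟩ := key (f a + Real.pi) (by
      rw [mem_uIcc]; left; constructor
      · linarith
      · rw [hn, hm]; nlinarith)
    rw [hn] at hk
    have h1 : (n : ℝ) + 1 / 2 = k := by
      have : ((n : ℝ) + 1 / 2 - k) * (2 * Real.pi) = 0 := by linarith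
      rcases mul_eq_zero.1 this with h | h
      · linarith
      · linarith
    have h2 : (2 * n + 1 : ℤ) = 2 * k := by
      have : (2 * n + 1 : ℝ) = 2 * k := by linarith
      exact_mod_cast this
    omega
  · have hnm : m < n := by
      rw [hn, hm] at h
      have := lt_of_mul_lt_mul_right h (by positivity)
      exact_mod_cast this
    have hnm' : (m : ℝ) + 1 ≤ n := by exact_mod_cast hnm
    obtain ⟨k, hk⟩ := key (f b + Real.pi) (by
      rw [mem_uIcc]; right; constructor
      · linarith
      · rw [hn, hm]; nlinarith)
    rw [hm] at hk
    have h1 : (m : ℝ) + 1 / 2 = k := by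
      have : ((m : ℝ) + 1 / 2 - k) * (2 * Real.pi) = 0 := by linarith
      rcases mul_eq_zero.1 this with h | h
      · linarith
      · linarith
    have h2 : (2 * m + 1 : ℤ) = 2 * k := by
      have : (2 * m + 1 : ℝ) = 2 * k := by linarith
      exact_mod_cast this
    omega

/-- existence of a continuous angle -/
lemma pb_lift (F : ℝ × ℝ → ℂ) (hF : Continuous F) (h0 : ∀ x, F x ≠ 0) :
    ∃ θ : ℝ × ℝ → ℝ, Continuous θ ∧ ∀ x, (θ x : Real.Angle) = (Complex.arg (F x) : ℝ) := by
  obtain ⟨Λ, ⟨-, h2⟩, -⟩ := Complex.isCoveringMapOn_exp.existsUnique_continuousMap_lifts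
      ⟨F, hF⟩ (Complex.exp_log (h0 (0, 0))) (fun x => by simpa using h0 x)
  refine ⟨fun x => (Λ x).im, by fun_prop, fun x => ?_⟩
  have : Complex.exp (Λ x) = F x := congrFun h2 x
  rw [← this, Complex.arg_exp]
  rw [← Real.Angle.coe_toIocMod]

lemma pb_theta (p : ℝ → ℂ) (hp : Continuous p) (T ε0 : ℝ) (hε : 0 < ε0)
    (hne : ∀ t t', T ≤ t → t + ε0 ≤ t' → p t ≠ p t') :
    ∃ Θ : ℝ × ℝ → ℝ, ContinuousOn Θ {x | T ≤ x.1 ∧ T ≤ x.2 ∧ ε0 ≤ |x.1 - x.2|} ∧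
      (∀ t t', T ≤ t → T ≤ t' → ε0 ≤ |t - t'| →
        (Θ (t, t') : Real.Angle) = (Complex.arg (p t - p t') : ℝ)) ∧
      ∀ t t', T ≤ t → t + ε0 ≤ t' → Θ (t', t) = Θ (t, t') + Real.pi := by
  obtain ⟨θ, hθ, hl⟩ := pb_lift
    (fun x => p (T + max x.1 0) - p (T + max x.1 0 + ε0 + max x.2 0)) (by fun_prop)
    (fun x => sub_ne_zero.2 (hne _ _ (by linarith [le_max_right x.1 0])
      (by linarith [le_max_right x.2 0])))
  set Θ0 : ℝ × ℝ → ℝ := fun x => θ (x.1 - T, x.2 - x.1 - ε0) with hΘ0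
  have c0 : Continuous Θ0 := by fun_prop
  have c1 : Continuous (fun x : ℝ × ℝ => Θ0 (x.2, x.1) + Real.pi) := by fun_prop
  have l0 : ∀ t t', T ≤ t → t + ε0 ≤ t' →
      (Θ0 (t, t') : Real.Angle) = (Complex.arg (p t - p t') : ℝ) := by
    intro t t' h1 h2
    have := hl (t - T, t' - t - ε0)
    simp only [hΘ0]
    rw [this, max_eq_left (by linarith), max_eq_left (by linarith)]
    ring_nf
  refine ⟨fun x => if x.1 < x.2 then Θ0 x else Θ0 (x.2, x.1) + Real.pi, ?_, ?_, ?_⟩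
  · intro x hx
    apply ContinuousAt.continuousWithinAt
    rcases lt_or_ge x.1 x.2 with h | h
    · apply c0.continuousAt.congr
      filter_upwards [(isOpen_lt continuous_fst continuous_snd).mem_nhds h] with y hy
      have : y.1 < y.2 := hy
      simp [this]
    · have h' : x.2 < x.1 := by
        rcases h.lt_or_eq with h | h
        · exact h
        · have := hx.2.2
          rw [h] at this; simp at this; linarith
      apply c1.continuousAt.congr
      filter_upwards [(isOpen_lt continuous_snd continuous_fst).mem_nhds h'] with y hy
      have : ¬ y.1 < y.2 := not_lt.2 (le_of_lt hy)
      simp [this]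
  · intro t t' h1 h2 h3
    rcases lt_or_ge t t' with h | h
    · simp only [h, if_true]
      apply l0 _ _ h1
      rw [abs_sub_comm, abs_of_pos (by linarith)] at h3
      linarith
    · have hn : ¬ t < t' := not_lt.2 h
      simp only [hn, if_false]
      rw [abs_of_nonneg (by linarith)] at h3
      rw [Real.Angle.coe_add, l0 _ _ h2 (by linarith)]
      rw [← Complex.arg_neg_coe_angle (sub_ne_zero.2 (hne t' t h2 (by linarith)))]
      rw [neg_sub]
  · intro t t' h1 h2
    have a : t < t' := by linarith
    have b : ¬ t' < t := not_lt.2 a.le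
    simp [a, b]

open Set Filter Topology MeasureTheory Bornology

lemma pb_core (A B : ℕ → ℕ → ℝ) (h : ℕ → ℝ) (P : ℕ → Prop) (hinf : {k | P k}.Infinite)
    (hconv : ∀ n n' k, P n → P n' → ¬ P k → (h n < h k ↔ h n' < h k))
    (he : ∀ i j, i ≠ j → A i j - B i j = if h i < h j then 1 else 0)
    (hs1 : ∀ i j, i < j → A j i = B i j + 1) (hs2 : ∀ i j, i < j → B j i = A i j)
    (hTr : ∀ n n' m, P n → P n' → (n < m ∧ n' < m) ∨ (m + 1 < n ∧ m + 1 < n') →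
      A n' (m + 1) - A n (m + 1) = B n' m - B n m) (n m : ℕ) (hnm : n + 2 ≤ m) :
    h (Nat.nth P n) < h (Nat.nth P m) ↔ h (Nat.nth P (n + 1)) < h (Nat.nth P (m + 1)) := by
  set g := Nat.nth P with hg
  have gP : ∀ k, P (g k) := fun k => Nat.nth_mem_of_infinite hinf k
  have gm : StrictMono g := Nat.nth_strictMono hinf
  have gap : ∀ k j, g k < j → j < g (k + 1) → ¬ P j := by
    intro k j h1 h2 h3
    obtain ⟨i, hi⟩ : ∃ i, g i = j := by
      have := Nat.range_nth_of_infinite hinf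
      have h4 : j ∈ Set.range (Nat.nth P) := by rw [this]; exact h3
      exact h4
    rw [← hi] at h1 h2
    have := gm.lt_iff_lt.1 h1
    have := gm.lt_iff_lt.1 h2
    omega
  have step : ∀ k n n', P n → P n' → (n < g k ∧ n' < g k) ∨ (g (k+1) < n ∧ g (k+1) < n') →
      A n' (g (k+1)) - A n (g (k+1)) = B n' (g k) - B n (g k) := by
    intro k n n' hn hn' hor
    have key : ∀ j, g k + j + 1 ≤ g (k+1) →
        A n' (g k + j + 1) - A n (g k + j + 1) = B n' (g k) - B n (g k) := by
      intro j
      induction j with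
      | zero => 
        intro hj
        exact hTr n n' (g k) hn hn' (by omega)
      | succ j ih =>
        intro hj
        have h1 := ih (by omega)
        have h2 := hTr n n' (g k + j + 1) hn hn' (by omega)
        have h3 : ¬ P (g k + j + 1) := gap k _ (by omega) (by omega)
        have h4 := he n (g k + j + 1) (by rintro rfl; exact h3 hn)
        have h5 := he n' (g k + j + 1) (by rintro rfl; exact h3 hn')
        have h6 := hconv n n' _ hn hn' h3
        simp only [h6] at h4
        rw [show g k + (j + 1) + 1 = g k + j + 1 + 1 by ring]
        linarith
    have hlt : g k < g (k+1) := gm (Nat.lt_succ_self k)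
    have := key (g (k+1) - g k - 1) (by omega)
    rwa [show g k + (g (k+1) - g k - 1) + 1 = g (k+1) by omega] at this
  have hnm1 : g n < g m := gm (by omega)
  have hnm2 : g (n+1) < g m := gm (by omega)
  have hnm3 : g (n+1) < g (m+1) := gm (by omega)
  have hnm4 : g n < g (m+1) := gm (by omega)
  have h1 := step m (g n) (g (n+1)) (gP _) (gP _) (by omega)
  have h2 := step n (g m) (g (m+1)) (gP _) (gP _) (by omega)
  rw [hs1 _ _ hnm2, hs1 _ _ hnm3, hs2 _ _ hnm4, hs2 _ _ hnm1] at h2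
  have h3 := he (g n) (g m) (by omega)
  have h4 := he (g (n+1)) (g (m+1)) (by omega)
  have h5 : (if h (g n) < h (g m) then (1:ℝ) else 0) = if h (g (n+1)) < h (g (m+1)) then 1 else 0 := by
    linarith
  by_cases a : h (g n) < h (g m) <;> by_cases b : h (g (n+1)) < h (g (m+1)) <;> simp [a, b] at h5 ⊢

lemma pb_seq_conv_aux (h : ℕ → ℝ) (z : ℝ) (hinj : ∀ i j, i ≠ j → h i ≠ h j)
    (hlag : ∀ n m, n + 2 ≤ m → (h n < h m ↔ h (n + 1) < h (m + 1)))
    (hz : ∀ ε > 0, ∀ N, ∃ n ≥ N, |h n - z| < ε) (h02 : h 0 < h 2) :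
    ∀ ε > 0, ∃ N, ∀ n ≥ N, |h n - z| < ε := by
  have lag : ∀ n d, 2 ≤ d → (h n < h (n + d) ↔ h 0 < h d) := by
    intro n d hd
    induction n with
    | zero => simp
    | succ n ih =>
      rw [← ih, hlag n (n + d) (by omega)]
      rw [show n + 1 + d = n + d + 1 by ring]
  have l2 : ∀ n, h n < h (n + 2) := fun n => (lag n 2 le_rfl).2 h02
  have l3 : ∀ n, h n < h (n + 3) := by
    have : h 0 < h 3 := by
      by_contra hc
      have a : ∀ n, h (n + 3) < h n := by
        intro n
        have := mt (lag n 3 (by omega)).1 hc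
        exact lt_of_le_of_ne (not_lt.1 this) (hinj _ _ (by omega))
      have := a 0
      have := a 3
      have := l2 0
      have := l2 2
      have := l2 4
      norm_num at *
      linarith
    exact fun n => (lag n 3 (by omega)).2 this
  have l : ∀ d n, h n < h (n + d + 2) := by
    intro d
    induction d using Nat.strong_induction_on with
    | _ d ih =>
      intro n
      match d with
      | 0 => exact l2 n
      | 1 => exact l3 n
      | d + 2 =>
        have := ih d (by omega) n
        exact this.trans (l2 _)
  have lt : ∀ n m, n + 2 ≤ m → h n < h m := by
    intro n m hm
    have := l (m - n - 2) n
    rwa [show n + (m - n - 2) + 2 = m by omega] at this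
  intro ε hε
  obtain ⟨N, -, hN⟩ := hz ε hε 0
  have ub : ∀ n, h n ≤ z := by
    intro n
    by_contra hc
    push Not at hc
    obtain ⟨m, hm, hm'⟩ := hz (h n - z) (by linarith) (n + 2)
    have := lt n m hm
    have := (abs_lt.1 hm').2
    linarith
  refine ⟨N + 2, fun n hn => ?_⟩
  have h1 := lt N n hn
  have h2 := ub n
  have := (abs_lt.1 hN).1
  rw [abs_lt]; constructor <;> linarith

lemma pb_seq_conv (h : ℕ → ℝ) (z : ℝ) (hinj : ∀ i j, i ≠ j → h i ≠ h j)
    (hlag : ∀ n m, n + 2 ≤ m → (h n < h m ↔ h (n + 1) < h (m + 1)))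
    (hz : ∀ ε > 0, ∀ N, ∃ n ≥ N, |h n - z| < ε) :
    ∀ ε > 0, ∃ N, ∀ n ≥ N, |h n - z| < ε := by
  by_cases h02 : h 0 < h 2
  · exact pb_seq_conv_aux h z hinj hlag hz h02
  · have e : ∀ n, |-h n - -z| = |h n - z| := fun n => by rw [← abs_neg]; ring_nf
    have := pb_seq_conv_aux (fun n => - h n) (-z) (fun i j hij => by simpa using hinj i j hij)
      (fun n m hnm => by
        have := hlag n m hnm
        have h1 := lt_of_le_of_ne (a := h n) (b := h m)
        have h1 := hinj n m (by omega)
        have h2 := hinj (n+1) (m+1) (by omega)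
        simp only [neg_lt_neg_iff]
        rw [← not_iff_not, not_lt, not_lt, le_iff_lt_or_eq, le_iff_lt_or_eq]
        simp [h1, h2, this])
      (by simpa only [e] using hz)
      (by
        have := lt_of_le_of_ne (not_lt.1 h02) (hinj _ _ (by omega))
        simpa using this)
    simpa only [e] using this

open Set Filter Topology MeasureTheory Bornology

lemma pb_arg_div {a b : ℂ} (ha : 0 < a.re) (hb : 0 < b.re) :
    Complex.arg (a / b) = Complex.arg a - Complex.arg b := by
  have ha0 : a ≠ 0 := by rintro rfl; simp at ha
  have hb0 : b ≠ 0 := by rintro rfl; simp at hb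
  have h1 := Complex.arg_div_coe_angle ha0 hb0
  rw [← Real.Angle.coe_sub] at h1
  have h2 := congrArg Real.Angle.toReal h1
  rw [Complex.arg_coe_angle_toReal_eq_arg] at h2
  rw [h2, Real.Angle.toReal_coe_eq_self_iff]
  have h3 := abs_lt.1 (Complex.abs_arg_lt_pi_div_two_iff.2 (Or.inl ha))
  have h4 := abs_lt.1 (Complex.abs_arg_lt_pi_div_two_iff.2 (Or.inl hb))
  constructor <;> linarith [h3.1, h3.2, h4.1, h4.2]

lemma pb_slit {a b c : ℂ} (h : c ∉ segment ℝ a b) : (b - c) / (a - c) ∈ Complex.slitPlane := by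
  have hac : a - c ≠ 0 := by
    intro h0
    rw [sub_eq_zero] at h0
    exact h (h0 ▸ left_mem_segment ℝ a b)
  by_contra hs
  rw [Complex.mem_slitPlane_iff] at hs
  push Not at hs
  obtain ⟨h1, h2⟩ := hs
  set q := (b - c) / (a - c) with hq
  have hq' : q = ((q.re : ℝ) : ℂ) := by
    apply Complex.ext <;> simp [h2]
  have hb : b - c = ((q.re : ℝ) : ℂ) * (a - c) := by
    rw [← hq', hq]; field_simp
  apply h
  set k := -q.re with hk
  have hk0 : 0 ≤ k := by linarith
  have hqk : q.re = -k := by linarith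
  refine ⟨k / (1 + k), 1 / (1 + k), by positivity, by positivity, by field_simp; ring, ?_⟩
  rw [hqk] at hb
  have h1k : (1 + (k : ℂ)) ≠ 0 := by
    have : (1 + k : ℝ) ≠ 0 := by positivity
    exact_mod_cast this
  have hb' : b = c + -(k : ℂ) * (a - c) := by
    rw [← sub_eq_iff_eq_add'] ; simpa using hb
  rw [hb']
  simp only [Complex.real_smul]
  push_cast
  field_simp
  ring


lemma pb_wind (p : ℝ → ℂ) (hp : Continuous p) (T ε0 : ℝ) (Θ : ℝ × ℝ → ℝ)
  (hΘ : ContinuousOn Θ {x | T ≤ x.1 ∧ T ≤ x.2 ∧ ε0 ≤ |x.1 - x.2|})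
  (hl : ∀ t t', T ≤ t → T ≤ t' → ε0 ≤ |t - t'| →
        (Θ (t, t') : Real.Angle) = (Complex.arg (p t - p t') : ℝ))
    (u v w : ℝ → ℝ) (hu : Continuous u) (hv : Continuous v) (hw : Continuous w)
    (a b : ℝ) (hab : a ≤ b) 
    (h1 : ∀ x ∈ Icc a b, T ≤ u x ∧ T ≤ v x ∧ T ≤ w x ∧ ε0 ≤ |u x - w x| ∧ ε0 ≤ |v x - w x|)
    (h2 : ∀ x ∈ Icc a b, p (w x) ∉ segment ℝ (p (u x)) (p (v x))) :
    Θ (v a, w a) - Θ (u a, w a) - Complex.arg ((p (v a) - p (w a)) / (p (u a) - p (w a))) =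
    Θ (v b, w b) - Θ (u b, w b) - Complex.arg ((p (v b) - p (w b)) / (p (u b) - p (w b))) := by
  apply pb_angle_const (f := fun x =>
    Θ (v x, w x) - Θ (u x, w x) - Complex.arg ((p (v x) - p (w x)) / (p (u x) - p (w x)))) hab
  · have c1 : ContinuousOn (fun x => Θ (v x, w x)) (Icc a b) :=
      hΘ.comp (f := fun x => (v x, w x)) (by fun_prop)
        (fun x hx => ⟨(h1 x hx).2.1, (h1 x hx).2.2.1, (h1 x hx).2.2.2.2⟩)
    have c2 : ContinuousOn (fun x => Θ (u x, w x)) (Icc a b) :=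
      hΘ.comp (f := fun x => (u x, w x)) (by fun_prop)
        (fun x hx => ⟨(h1 x hx).1, (h1 x hx).2.2.1, (h1 x hx).2.2.2.1⟩)
    refine (c1.sub c2).sub ?_
    intro x hx
    apply ContinuousAt.continuousWithinAt
    have hs := pb_slit (h2 x hx)
    apply ContinuousAt.comp (f := fun x => (p (v x) - p (w x)) / (p (u x) - p (w x)))
      (Complex.continuousAt_arg hs)
    apply ContinuousAt.div (by fun_prop) (by fun_prop)
    intro h0
    rw [sub_eq_zero] at h0
    exact h2 x hx (h0 ▸ left_mem_segment ℝ _ _)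
  · intro x hx
    obtain ⟨a1, a2, a3, a4, a5⟩ := h1 x hx
    have hu0 : p (u x) - p (w x) ≠ 0 := by
      intro h0
      rw [sub_eq_zero] at h0
      exact h2 x hx (h0 ▸ left_mem_segment ℝ _ _)
    have hv0 : p (v x) - p (w x) ≠ 0 := by
      intro h0
      rw [sub_eq_zero] at h0
      exact h2 x hx (h0 ▸ right_mem_segment ℝ _ _)
    rw [Real.Angle.coe_sub, Real.Angle.coe_sub, hl _ _ a2 a3 a5, hl _ _ a1 a3 a4,
      Complex.arg_div_coe_angle hv0 hu0, sub_self]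

/-- moving the first variable -/
lemma pb_move1 (p : ℝ → ℂ) (hp : Continuous p) (T ε0 : ℝ) (Θ : ℝ × ℝ → ℝ)
  (hΘ : ContinuousOn Θ {x | T ≤ x.1 ∧ T ≤ x.2 ∧ ε0 ≤ |x.1 - x.2|})
  (hl : ∀ t t', T ≤ t → T ≤ t' → ε0 ≤ |t - t'| →
        (Θ (t, t') : Real.Angle) = (Complex.arg (p t - p t') : ℝ))
    (a b s : ℝ) (hab : a ≤ b) 
    (h1 : ∀ x ∈ Icc a b, T ≤ x ∧ T ≤ s ∧ ε0 ≤ |x - s|)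
    (h2 : ∀ x ∈ Icc a b, p x - p s ∈ Complex.slitPlane) :
    Θ (a, s) - Complex.arg (p a - p s) = Θ (b, s) - Complex.arg (p b - p s) := by
  apply pb_angle_const (f := fun x => Θ (x, s) - Complex.arg (p x - p s)) hab
  · have c1 : ContinuousOn (fun x => Θ (x, s)) (Icc a b) :=
      hΘ.comp (f := fun x => (x, s)) (by fun_prop) (fun x hx => h1 x hx)
    refine c1.sub ?_
    intro x hx
    apply ContinuousAt.continuousWithinAt
    apply ContinuousAt.comp (f := fun x => (p x - p s)) (Complex.continuousAt_arg (h2 x hx))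
    fun_prop
  · intro x hx
    obtain ⟨a1, a2, a3⟩ := h1 x hx
    rw [Real.Angle.coe_sub, hl _ _ a1 a2 a3, sub_self]

lemma pb_move2 (p : ℝ → ℂ) (hp : Continuous p) (T ε0 : ℝ) (Θ : ℝ × ℝ → ℝ)
  (hΘ : ContinuousOn Θ {x | T ≤ x.1 ∧ T ≤ x.2 ∧ ε0 ≤ |x.1 - x.2|})
  (hl : ∀ t t', T ≤ t → T ≤ t' → ε0 ≤ |t - t'| →
        (Θ (t, t') : Real.Angle) = (Complex.arg (p t - p t') : ℝ))
    (a b s : ℝ) (hab : a ≤ b) 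
    (h1 : ∀ x ∈ Icc a b, T ≤ s ∧ T ≤ x ∧ ε0 ≤ |s - x|)
    (h2 : ∀ x ∈ Icc a b, p x - p s ∈ Complex.slitPlane) :
    Θ (s, a) - Complex.arg (p a - p s) = Θ (s, b) - Complex.arg (p b - p s) := by
  have : Θ (s, a) - Complex.arg (p a - p s) - Real.pi
      = Θ (s, b) - Complex.arg (p b - p s) - Real.pi := by
    apply pb_angle_const (f := fun x => Θ (s, x) - Complex.arg (p x - p s) - Real.pi) hab
    · have c1 : ContinuousOn (fun x => Θ (s, x)) (Icc a b) :=
        hΘ.comp (f := fun x => (s, x)) (by fun_prop) (fun x hx => h1 x hx)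
      refine (c1.sub ?_).sub continuousOn_const
      intro x hx
      apply ContinuousAt.continuousWithinAt
      apply ContinuousAt.comp (f := fun x => (p x - p s)) (Complex.continuousAt_arg (h2 x hx))
      fun_prop
    · intro x hx
      obtain ⟨a1, a2, a3⟩ := h1 x hx
      rw [Real.Angle.coe_sub, Real.Angle.coe_sub, hl _ _ a1 a2 a3]
      have h0 : p x - p s ≠ 0 := Complex.slitPlane_ne_zero (h2 x hx)
      rw [← neg_sub (p x) (p s), Complex.arg_neg_coe_angle h0]
      simp
  linarith

lemma pb_planar_core (p : ℝ → ℂ) (hp : Continuous p) (T ε0 : ℝ) (hε : 0 < ε0)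
    (hne : ∀ t t', T ≤ t → t + ε0 ≤ t' → p t ≠ p t') (l r : ℕ → ℝ) (c1 c2 : ℝ) (hc : c1 < c2)
    (hT : ∀ n, T ≤ l n) (hlr : ∀ n, l n ≤ r n) (hsep : ∀ i j, i < j → r i + ε0 ≤ l j)
    (hl : ∀ n, (p (l n)).re = c1) (hr : ∀ n, (p (r n)).re = c2)
    (hm : ∀ n, ∀ t ∈ Icc (l n) (r n), c1 ≤ (p t).re)
    (P : ℕ → Prop) (hinf : {k | P k}.Infinite)
    (hconv : ∀ n n' k, P n → P n' → ¬ P k →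
      ((p (l n)).im < (p (l k)).im ↔ (p (l n')).im < (p (l k)).im))
    (hpath : ∀ n n' m, P n → P n' → (n < m ∧ n' < m) ∨ (m + 1 < n ∧ m + 1 < n') →
      ∃ s, r m ≤ s ∧ s ≤ l (m + 1) ∧
        (∀ t ∈ Icc (r m) s, p t ∉ segment ℝ (p (l n)) (p (l n'))) ∧
        (∀ σ ∈ Icc (0:ℝ) 1, p s ∉ segment ℝ (p (l n + σ * (r n - l n)))
          (p (l n' + σ * (r n' - l n')))) ∧
        (∀ t ∈ Icc s (l (m + 1)), p t ∉ segment ℝ (p (r n)) (p (r n'))))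
    (n m : ℕ) (hnm : n + 2 ≤ m) :
    (p (l (Nat.nth P n))).im < (p (l (Nat.nth P m))).im ↔
      (p (l (Nat.nth P (n + 1)))).im < (p (l (Nat.nth P (m + 1)))).im := by
  obtain ⟨Θ, hΘ, hlf, hsw⟩ := pb_theta p hp T ε0 hε hne
  have hpi := Real.pi_pos
  have habs : ∀ i j, i ≠ j → ∀ t ∈ Icc (l i) (r i), ∀ t' ∈ Icc (l j) (r j), ε0 ≤ |t - t'| := by
    intro i j hij t ht t' ht'
    rcases lt_or_gt_of_ne hij with h | h
    · have := hsep i j h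
      rw [abs_sub_comm, abs_of_nonneg (by linarith [ht.2, ht'.1])]
      linarith [ht.2, ht'.1]
    · have := hsep j i h
      rw [abs_of_nonneg (by linarith [ht.1, ht'.2])]
      linarith [ht.1, ht'.2]
  have hne' : ∀ t t', T ≤ t → T ≤ t' → ε0 ≤ |t - t'| → p t - p t' ≠ 0 := by
    intro t t' h1 h2 h3
    rw [sub_ne_zero]
    rcases le_total t t' with h | h
    · rw [abs_sub_comm, abs_of_nonneg (by linarith)] at h3
      exact hne t t' h1 (by linarith)
    · rw [abs_of_nonneg (by linarith)] at h3
      exact (hne t' t h2 (by linarith)).symm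
  have hlmem : ∀ n, l n ∈ Icc (l n) (r n) := fun n => ⟨le_rfl, hlr n⟩
  have hrmem : ∀ n, r n ∈ Icc (l n) (r n) := fun n => ⟨hlr n, le_rfl⟩
  have hTr : ∀ n, T ≤ r n := fun n => (hT n).trans (hlr n)
  refine pb_core
    (fun i j => (Θ (r i, l j) - Complex.arg (p (r i) - p (l j))) / (2 * Real.pi))
    (fun i j => (Θ (l i, r j) - Real.pi - Complex.arg (p (r j) - p (l i))) / (2 * Real.pi))
    (fun i => (p (l i)).im) P hinf hconv ?_ ?_ ?_ ?_ n m hnm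
  · intro i j hij
    have hslit : ∀ x s, T ≤ x → T ≤ s → ε0 ≤ |x - s| → (p s).re = c1 → c1 ≤ (p x).re →
        p x - p s ∈ Complex.slitPlane := by
      intro x s h1 h2 h3 h4 h5
      rw [Complex.mem_slitPlane_iff]
      by_contra hcon
      push Not at hcon
      have h6 := hne' x s h1 h2 h3
      apply h6
      apply Complex.ext
      · apply le_antisymm
        · simpa using hcon.1
        · simp [h4, h5]
      · simpa using hcon.2
    have e1 := pb_move1 p hp T ε0 Θ hΘ hlf (l i) (r i) (l j) (hlr i)
      (fun x hx => ⟨(hT i).trans hx.1, hT j, habs i j hij x hx _ (hlmem j)⟩)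
      (fun x hx => hslit _ _ ((hT i).trans hx.1) (hT j) (habs i j hij x hx _ (hlmem j)) (hl j)
        (hm i x hx))
    have e2 := pb_move2 p hp T ε0 Θ hΘ hlf (l j) (r j) (l i) (hlr j)
      (fun x hx => ⟨hT i, (hT j).trans hx.1, habs i j hij _ (hlmem i) x hx⟩)
      (fun x hx => hslit _ _ ((hT j).trans hx.1) (hT i) (habs j i hij.symm x hx _ (hlmem i)) (hl i)
        (hm j x hx))
    have hne1 := hne' (l i) (l j) (hT i) (hT j) (habs i j hij _ (hlmem i) _ (hlmem j))
    rw [← sub_div, div_eq_iff (by positivity)]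
    have him : (p (l i)).im ≠ (p (l j)).im := by
      intro h
      apply hne1
      apply Complex.ext <;> simp [hl, h]
    split_ifs with hlt
    · have a1 : Complex.arg (p (l i) - p (l j)) = -(Real.pi / 2) := by
        rw [Complex.arg_eq_neg_pi_div_two_iff]; simp [hl, hlt]
      have a2 : Complex.arg (p (l j) - p (l i)) = (Real.pi / 2) := by
        rw [Complex.arg_eq_pi_div_two_iff]; simp [hl, hlt]
      linarith
    · have hlt' := lt_of_le_of_ne (not_lt.1 hlt) him.symm
      have a1 : Complex.arg (p (l i) - p (l j)) = (Real.pi / 2) := by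
        rw [Complex.arg_eq_pi_div_two_iff]; simp [hl, hlt']
      have a2 : Complex.arg (p (l j) - p (l i)) = -(Real.pi / 2) := by
        rw [Complex.arg_eq_neg_pi_div_two_iff]; simp [hl, hlt']
      linarith
  · intro i j hij
    have := hsw (l i) (r j) (hT i) (by linarith [hsep i j hij, hlr i, hlr j])
    rw [this]
    field_simp
    ring
  · intro i j hij
    have := hsw (r i) (l j) (hTr i) (by linarith [hsep i j hij, hlr i, hlr j])
    rw [this]
    ring
  · intro n n' m hn hn' hor
    obtain ⟨s, hs1, hs2, h1, h2, h3⟩ := hpath n n' m hn hn' hor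
    have hsT : T ≤ r m := hTr m
    have far : ∀ k, k < m ∨ m + 1 < k → ∀ t ∈ Icc (l k) (r k), ∀ t' ∈ Icc (r m) (l (m+1)),
        T ≤ t ∧ T ≤ t' ∧ ε0 ≤ |t - t'| := by
      intro k hk t ht t' ht'
      refine ⟨(hT k).trans ht.1, (hTr m).trans ht'.1, ?_⟩
      rcases hk with h | h
      · have := hsep k m h
        rw [abs_sub_comm, abs_of_nonneg] <;> linarith [ht.2, ht'.1, hlr m]
      · have := hsep (m+1) k h
        rw [abs_of_nonneg] <;> linarith [ht.1, ht'.2, hlr (m+1)]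
    have farn := far n (by omega)
    have farn' := far n' (by omega)
    have w1 := pb_wind p hp T ε0 Θ hΘ hlf (fun _ => l n) (fun _ => l n') (fun x => x)
      (by fun_prop) (by fun_prop) (by fun_prop) (r m) s hs1
      (fun x hx => by
        have a := farn _ (hlmem n) x ⟨hx.1, hx.2.trans hs2⟩
        have b := farn' _ (hlmem n') x ⟨hx.1, hx.2.trans hs2⟩
        exact ⟨a.1, b.1, a.2.1, a.2.2, b.2.2⟩) h1
    have w3 := pb_wind p hp T ε0 Θ hΘ hlf (fun _ => r n) (fun _ => r n') (fun x => x)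
      (by fun_prop) (by fun_prop) (by fun_prop) s (l (m+1)) hs2
      (fun x hx => by
        have a := farn _ (hrmem n) x ⟨hs1.trans hx.1, hx.2⟩
        have b := farn' _ (hrmem n') x ⟨hs1.trans hx.1, hx.2⟩
        exact ⟨a.1, b.1, a.2.1, a.2.2, b.2.2⟩) h3
    have w2 := pb_wind p hp T ε0 Θ hΘ hlf (fun σ => l n + σ * (r n - l n))
      (fun σ => l n' + σ * (r n' - l n')) (fun x => s)
      (by fun_prop) (by fun_prop) (by fun_prop) 0 1 (by norm_num)
      (fun x hx => by
        have mm : ∀ k, l k + x * (r k - l k) ∈ Icc (l k) (r k) := fun k => 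
          ⟨by nlinarith [hlr k, hx.1], by nlinarith [hlr k, hx.2]⟩
        have a := farn _ (mm n) s ⟨hs1, hs2⟩
        have b := farn' _ (mm n') s ⟨hs1, hs2⟩
        exact ⟨a.1, b.1, a.2.1, a.2.2, b.2.2⟩) h2
    simp only [zero_mul, add_zero, one_mul, add_sub_cancel] at w1 w2 w3
    have q1 : Complex.arg ((p (l n') - p (r m)) / (p (l n) - p (r m))) =
        Complex.arg (p (r m) - p (l n')) - Complex.arg (p (r m) - p (l n)) := by
      rw [← pb_arg_div (by simp [hl, hr, hc]) (by simp [hl, hr, hc])]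
      rw [← neg_sub, ← neg_sub (p (r m)) (p (l n)), neg_div_neg_eq]
    have q2 : Complex.arg ((p (r n') - p (l (m+1))) / (p (r n) - p (l (m+1)))) =
        Complex.arg (p (r n') - p (l (m+1))) - Complex.arg (p (r n) - p (l (m+1))) := by
      rw [← pb_arg_div (by simp [hl, hr, hc]) (by simp [hl, hr, hc])]
    rw [← sub_div, ← sub_div]
    congr 1
    rw [q1] at w1
    rw [q2] at w3
    linarith

open Set Filter Topology MeasureTheory Bornology

/-- first time a continuous function exceeds the level `c` -/
lemma pb_first {g : ℝ → ℝ} (hg : Continuous g) {a b c : ℝ} (hab : a ≤ b) (ha : g a < c)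
    (hb : c < g b) : ∃ s, a < s ∧ s < b ∧ g s = c ∧ (∀ t ∈ Icc a s, g t ≤ c) ∧
      ∀ κ > 0, ∃ t, s < t ∧ t < s + κ ∧ t < b + κ ∧ c < g t := by
  set A : Set ℝ := {t | t ∈ Icc a b ∧ c < g t} with hA
  have hne : A.Nonempty := ⟨b, ⟨hab, le_rfl⟩, hb⟩
  have hbd : BddBelow A := ⟨a, fun t ht => ht.1.1⟩
  set s := sInf A with hs
  have has : a ≤ s := le_csInf hne (fun t ht => ht.1.1)
  have hsb : s ≤ b := csInf_le hbd ⟨⟨hab, le_rfl⟩, hb⟩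
  have hle : ∀ t ∈ Ico a s, g t ≤ c := by
    intro t ht
    by_contra hc
    exact absurd (csInf_le hbd ⟨⟨ht.1, ht.2.le.trans hsb⟩, not_le.1 hc⟩) (not_le.2 ht.2)
  have hge : c ≤ g s := by
    by_contra hc
    push Not at hc
    have : ∀ᶠ t in 𝓝 s, g t < c := hg.continuousAt.eventually_lt continuousAt_const hc
    obtain ⟨d, hd, hd'⟩ := Metric.eventually_nhds_iff.1 this
    obtain ⟨t, ht, ht'⟩ := exists_lt_of_csInf_lt hne (show sInf A < s + d by linarith)
    have h1 : s ≤ t := csInf_le hbd ht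
    have := hd' (y := t) (by rw [Real.dist_eq, abs_of_nonneg (by linarith)]; linarith)
    linarith [ht.2]
  have has' : a < s := by
    rcases has.lt_or_eq with h | h
    · exact h
    · rw [← h] at hge; linarith
  have hgs : g s ≤ c := by
    by_contra hc
    push Not at hc
    have : ∀ᶠ t in 𝓝 s, c < g t := continuousAt_const.eventually_lt hg.continuousAt hc
    obtain ⟨d, hd, hd'⟩ := Metric.eventually_nhds_iff.1 this
    have h2 := hd' (y := max a (s - d/2)) (by
      rw [Real.dist_eq, abs_sub_comm, abs_of_nonneg (by simp; constructor <;> linarith)]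
      have := le_max_right a (s - d/2)
      linarith)
    have h3 := hle (max a (s - d/2)) ⟨le_max_left _ _, max_lt has' (by linarith)⟩
    linarith
  have hgs' := le_antisymm hgs hge
  refine ⟨s, has', lt_of_le_of_ne hsb (by rintro h; rw [h] at hgs; linarith), hgs', ?_, ?_⟩
  · intro t ht
    rcases ht.2.lt_or_eq with h | h
    · exact hle t ⟨ht.1, h⟩
    · rw [h]; exact hgs
  · intro κ hκ
    obtain ⟨t, ht, ht'⟩ := exists_lt_of_csInf_lt hne (show sInf A < s + κ by linarith)
    have h1 : s ≤ t := csInf_le hbd ht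
    refine ⟨t, lt_of_le_of_ne h1 ?_, ht', by linarith [ht.1.2], ht.2⟩
    rintro h
    have := ht.2
    rw [← h] at this; linarith

/-- last time a continuous function is below the level `c` -/
lemma pb_last {g : ℝ → ℝ} (hg : Continuous g) {a b c : ℝ} (hab : a ≤ b) (ha : g a < c)
    (hb : c < g b) : ∃ s, a < s ∧ s < b ∧ g s = c ∧ (∀ t ∈ Icc s b, c ≤ g t) ∧
      ∀ κ > 0, ∃ t, t < s ∧ s - κ < t ∧ a - κ < t ∧ g t < c := by
  obtain ⟨s, h1, h2, h3, h4, h5⟩ := pb_first (g := fun x => - g (-x)) (by fun_prop)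
    (a := -b) (b := -a) (c := -c) (by linarith) (by simpa using hb) (by simpa using ha)
  refine ⟨-s, by linarith, by linarith, by linarith, ?_, ?_⟩
  · intro t ht
    have := h4 (-t) ⟨by linarith [ht.2], by linarith [ht.1]⟩
    simpa using this
  · intro κ hκ
    obtain ⟨t, a1, a2, a3, a4⟩ := h5 κ hκ
    exact ⟨-t, by linarith, by linarith, by linarith, by linarith⟩

lemma pb_tilt {f : ℝ → ℝ} (hf : Continuous f) {a b : ℝ} (hab : a < b) (h : f a < f b) :
    ∃ s1 s2 L, a < s1 ∧ s1 < s2 ∧ s2 < b ∧ 0 < L ∧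
      (∀ s ∈ Icc a s2, f s ≤ f s2 - L * (s2 - s)) ∧
      (∀ s ∈ Icc s1 s2, f s1 + L * (s - s1) ≤ f s) ∧
      (∀ κ > 0, ∃ s, s < s1 ∧ s1 - κ < s ∧ f s < f s1) ∧
      (∀ κ > 0, ∃ s, s2 < s ∧ s < s2 + κ ∧ f s2 < f s) := by
  set L := (f b - f a) / (2 * (b - a)) with hL
  have hL0 : 0 < L := by apply div_pos <;> linarith
  have hLe : L * (b - a) = (f b - f a) / 2 := by
    rw [hL]; field_simp [(by linarith : b - a ≠ 0)]
  set g : ℝ → ℝ := fun t => f t - L * t with hg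
  have hgc : Continuous g := by fun_prop
  have hgab : g b - g a = (f b - f a) / 2 := by simp only [hg]; linarith
  obtain ⟨s2, h1, h2, h3, h4, h5⟩ := pb_first hgc (c := g a + (g b - g a) * 2 / 3) hab.le
    (by linarith) (by linarith)
  obtain ⟨s1, k1, k2, k3, k4, k5⟩ := pb_last hgc (c := g a + (g b - g a) / 3) h1.le
    (by linarith) (by rw [h3]; linarith)
  refine ⟨s1, s2, L, k1, k2, h2, hL0, ?_, ?_, ?_, ?_⟩
  · intro s hs
    have := h4 s hs
    rw [← h3] at this
    simp only [hg] at this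
    linarith
  · intro s hs
    have := k4 s hs
    rw [← k3] at this
    simp only [hg] at this
    linarith
  · intro κ hκ
    obtain ⟨s, a1, a2, a3, a4⟩ := k5 κ hκ
    refine ⟨s, a1, a2, ?_⟩
    rw [← k3] at a4
    simp only [hg] at a4
    nlinarith
  · intro κ hκ
    obtain ⟨s, a1, a2, a3, a4⟩ := h5 κ hκ
    refine ⟨s, a1, a2, ?_⟩
    rw [← h3] at a4
    simp only [hg] at a4
    nlinarith

/-- increasing enumeration of a separated set -/
lemma pb_enum (S : Set ℝ) (g T : ℝ) (hg : 0 < g) (hT : ∀ x ∈ S, T ≤ x)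
    (hsep : ∀ x ∈ S, ∀ y ∈ S, |x - y| < g → x = y) (hub : ∀ a, ∃ x ∈ S, a < x) :
    ∃ l : ℕ → ℝ, (∀ n, l n ∈ S) ∧ (∀ i j, i < j → l i + g ≤ l j) ∧ (∀ x ∈ S, ∃ n, l n = x) := by
  have next : ∀ a, ∃ y ∈ S, a < y ∧ ∀ z ∈ S, a < z → y ≤ z := by
    intro a
    set A := {z | z ∈ S ∧ a < z} with hA
    have hne : A.Nonempty := by
      obtain ⟨x, hx, hx'⟩ := hub a
      exact ⟨x, hx, hx'⟩
    have hbd : BddBelow A := ⟨a, fun t ht => ht.2.le⟩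
    obtain ⟨y, hy, hy'⟩ := exists_lt_of_csInf_lt hne (show sInf A < sInf A + g by linarith)
    refine ⟨y, hy.1, hy.2, fun z hz hz' => ?_⟩
    by_contra hc
    push Not at hc
    have h1 : sInf A ≤ z := csInf_le hbd ⟨hz, hz'⟩
    have := hsep z hz y hy.1 (by rw [abs_sub_comm, abs_of_pos (by linarith)]; linarith)
    linarith
  choose nx n1 n2 n3 using next
  set l : ℕ → ℝ := fun n => Nat.rec (nx (T - 1)) (fun _ x => nx x) n with hl
  have l0 : l 0 = nx (T - 1) := rfl
  have ls : ∀ n, l (n+1) = nx (l n) := fun n => rfl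
  have lS : ∀ n, l n ∈ S := by
    intro n
    cases n with
    | zero => rw [l0]; exact n1 _
    | succ n => rw [ls]; exact n1 _
  have lstep : ∀ n, l n + g ≤ l (n+1) := by
    intro n
    have h1 : l n < l (n+1) := by rw [ls]; exact n2 _
    by_contra hc
    push Not at hc
    have := hsep _ (lS (n+1)) _ (lS n) (by rw [abs_of_pos (by linarith)]; linarith)
    linarith
  have lmono : Monotone l := monotone_nat_of_le_succ (fun n => by linarith [lstep n])
  have lgrow : ∀ n : ℕ, T + n * g ≤ l n := by
    intro n
    induction n with
    | zero => simpa using hT _ (lS 0)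
    | succ n ih => push_cast; linarith [lstep n]
  refine ⟨l, lS, ?_, ?_⟩
  · intro i j hij
    exact (lstep i).trans (lmono hij)
  · intro x hx
    have hex : ∃ n, x < l n := by
      obtain ⟨n, hn⟩ := exists_nat_gt ((x - T) / g)
      rw [div_lt_iff₀ hg] at hn
      exact ⟨n, by linarith [lgrow n]⟩
    classical
    have h1 := Nat.find_spec hex
    rcases hk : Nat.find hex with _ | k
    · rw [hk, l0] at h1
      have := n3 (T - 1) x hx (by linarith [hT x hx])
      linarith
    · rw [hk] at h1
      have h2 : ¬ x < l k := Nat.find_min hex (by omega)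
      refine ⟨k, ?_⟩
      by_contra hne
      have h3 := n3 (l k) x hx (lt_of_le_of_ne (not_lt.1 h2) hne)
      rw [← ls] at h3
      linarith

/-- an upward crossing of the strip `c1 ≤ Re ≤ c2` -/
def pbUp (p : ℝ → ℂ) (c1 c2 l r : ℝ) : Prop :=
  l < r ∧ (p l).re = c1 ∧ (p r).re = c2 ∧ ∀ t ∈ Ioc l r, c1 < (p t).re

lemma pb_exp (p ζ : ℝ → ℂ) (hp : Continuous p) (hζ : Continuous ζ) (M a b s1 s2 L : ℝ)
    (ha : a < s1) (h12 : s1 < s2) (hb : s2 < b) (hM : b - a < M) (hL : 0 < L)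
    (h1 : ∀ s ∈ Icc a s2, (ζ s).re ≤ (ζ s2).re - L * (s2 - s))
    (h2 : ∀ s ∈ Icc s1 s2, (ζ s1).re + L * (s - s1) ≤ (ζ s).re)
    (h3 : ∀ κ > 0, ∃ s, s < s1 ∧ s1 - κ < s ∧ (ζ s).re < (ζ s1).re)
    (h4 : ∀ κ > 0, ∃ s, s2 < s ∧ s < s2 + κ ∧ (ζ s2).re < (ζ s).re)
    (D1 : ∀ s0, ∀ η > 0, ∃ ρ > 0, ∃ T, ∀ t ≥ T, ‖p t - ζ s0‖ < ρ → ∀ s, |s| ≤ M →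
      ‖p (t + s) - ζ (s0 + s)‖ < η) (ε : ℝ) (hε : 0 < ε) :
    ∃ ρ > 0, ∃ T, ∀ t ≥ T, ‖p t - ζ s1‖ < ρ → ∃ l r, |l - t| < ε ∧ |r - l - (s2 - s1)| < ε ∧
      pbUp p (ζ s1).re (ζ s2).re l r ∧ ‖p l - ζ s1‖ < ε := by
  set c1 := (ζ s1).re with hc1
  set c2 := (ζ s2).re with hc2
  have hc : c1 < c2 := by
    have := h2 s2 ⟨h12.le, le_rfl⟩
    nlinarith [mul_pos hL (sub_pos.2 h12)]
  obtain ⟨e1, he1, he1'⟩ := Metric.continuousAt_iff.1 (hζ.continuousAt (x := s1)) (ε/2) (by linarith)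
  obtain ⟨e2, he2, he2'⟩ := Metric.continuousAt_iff.1 (hζ.continuousAt (x := s2)) ((c2-c1)/2)
    (by linarith)
  obtain ⟨ε', hε', k1, k2, k3, k4, k5, k6⟩ : ∃ ε' > 0, ε' < e1 ∧ ε' < e2 ∧ 2 * ε' < ε ∧
      2 * ε' < s2 - s1 ∧ ε' < s1 - a ∧ ε' < b - s2 := by
    refine ⟨(min e1 (min e2 (min ε (min (s2 - s1) (min (s1 - a) (b - s2)))))) / 3, ?_, ?_⟩
    · have : 0 < min e1 (min e2 (min ε (min (s2 - s1) (min (s1 - a) (b - s2))))) := by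
        simp only [lt_min_iff]; refine ⟨he1, he2, hε, ?_, ?_, ?_⟩ <;> linarith
      linarith
    · set m := min e1 (min e2 (min ε (min (s2 - s1) (min (s1 - a) (b - s2))))) with hm
      have hm0 : 0 < m := by
        simp only [hm, lt_min_iff]; refine ⟨he1, he2, hε, ?_, ?_, ?_⟩ <;> linarith
      have := le_min_iff.1 hm.le
      simp only [le_min_iff] at this
      obtain ⟨q1, q2, q3, q4, q5, q6⟩ := this
      refine ⟨?_, ?_, ?_, ?_, ?_, ?_⟩ <;> linarith
  obtain ⟨sm, hm1, hm2, hm3⟩ := h3 ε' hε'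
  obtain ⟨sp, hp1, hp2, hp3⟩ := h4 ε' hε'
  obtain ⟨η, hη, η1, η2, η3, η4, η5⟩ : ∃ η > 0, η < c1 - (ζ sm).re ∧ η < (ζ sp).re - c2 ∧
      η < L * ε' ∧ η < (c2 - c1) / 2 ∧ η < ε / 2 := by
    have : 0 < L * ε' := mul_pos hL hε'
    set m := min (c1 - (ζ sm).re) (min ((ζ sp).re - c2) (min (L * ε') (min ((c2 - c1) / 2) (ε/2))))
      with hm
    have hm0 : 0 < m := by
      simp only [hm, lt_min_iff]; refine ⟨?_, ?_, ?_, ?_, ?_⟩ <;> linarith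
    have := le_min_iff.1 hm.le
    simp only [le_min_iff] at this
    obtain ⟨q1, q2, q3, q4, q5⟩ := this
    refine ⟨m/2, by linarith, ?_, ?_, ?_, ?_, ?_⟩ <;> linarith
  obtain ⟨ρ, hρ, T, hT⟩ := D1 s1 η hη
  refine ⟨ρ, hρ, T, fun t ht htρ => ?_⟩
  have cl := hT t ht htρ
  set F : ℝ → ℝ := fun s => (p (t + (s - s1))).re with hF
  have hFc : Continuous F := by fun_prop
  have hcl : ∀ s ∈ Icc a b, ‖p (t + (s - s1)) - ζ s‖ < η := by
    intro s hs
    have := cl (s - s1) (by rw [abs_le]; constructor <;> linarith [hs.1, hs.2])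
    rwa [add_sub_cancel] at this
  have hcr : ∀ s ∈ Icc a b, |F s - (ζ s).re| < η := by
    intro s hs
    have := (Complex.abs_re_le_norm _).trans_lt (hcl s hs)
    simpa [hF] using this
  have i1 := abs_lt.1 (hcr sm ⟨by linarith, by linarith⟩)
  have i2 := abs_lt.1 (hcr sp ⟨by linarith, by linarith⟩)
  obtain ⟨R, r1, r2, r3, r4, -⟩ := pb_first hFc (a := sm) (b := sp) (c := c2) (by linarith)
    (by linarith [i1.2]) (by linarith [i2.1])
  have hR1 : s2 - ε' < R := by
    by_contra hcon
    push Not at hcon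
    have := h1 R ⟨by linarith, by linarith⟩
    have i3 := abs_lt.1 (hcr R ⟨by linarith, by linarith⟩)
    have : L * ε' ≤ L * (s2 - R) := by apply mul_le_mul_of_nonneg_left <;> linarith
    linarith [i3.2]
  have hR2 : R < s2 + ε' := by linarith
  obtain ⟨l, l1, l2, l3, l4, -⟩ := pb_last hFc (a := sm) (b := R) (c := c1) r1.le
    (by linarith [i1.2]) (by linarith)
  -- last time with value exactly c1
  obtain ⟨l, l1, l2, l3, l4⟩ : ∃ l, sm ≤ l ∧ l < R ∧ F l = c1 ∧ ∀ s ∈ Ioc l R, c1 < F s := by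
    have hcomp : IsCompact (Icc sm R ∩ F ⁻¹' {c1}) :=
      isCompact_Icc.inter_right (isClosed_singleton.preimage hFc)
    obtain ⟨x, hx, hx'⟩ := hcomp.exists_isGreatest ⟨l, ⟨l1.le, l2.le⟩, l3⟩
    have hFx : F x = c1 := hx.2
    refine ⟨x, hx.1.1, lt_of_le_of_ne hx.1.2 (by rintro h; rw [h] at hFx; linarith), hFx, ?_⟩
    intro s hs
    by_contra hcon
    push Not at hcon
    obtain ⟨y, hy, hy'⟩ := intermediate_value_Icc hs.2 hFc.continuousOn
      (show c1 ∈ Icc (F s) (F R) from ⟨hcon, by linarith⟩)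
    have := hx' ⟨⟨by linarith [hx.1.1, hs.1, hy.1], hy.2⟩, hy'⟩
    linarith [hs.1, hy.1]
  have hl1 : s1 - ε' < l := by linarith
  have hl2 : l < s1 + ε' := by
    by_contra hcon
    push Not at hcon
    have i3 := abs_lt.1 (hcr l ⟨by linarith, by linarith⟩)
    rcases le_total l s2 with h | h
    · have := h2 l ⟨by linarith, h⟩
      have : L * ε' ≤ L * (l - s1) := by apply mul_le_mul_of_nonneg_left <;> linarith
      linarith [i3.1]
    · have := he2' (x := l) (by rw [Real.dist_eq, abs_of_nonneg (by linarith)]; linarith)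
      rw [Complex.dist_eq] at this
      have := (Complex.abs_re_le_norm _).trans_lt this
      rw [Complex.sub_re] at this
      have := abs_lt.1 this
      linarith [i3.1]
  refine ⟨t + (l - s1), t + (R - s1), ?_, ?_, ⟨by linarith, l3, r3, ?_⟩, ?_⟩
  · rw [abs_lt]; constructor <;> linarith
  · rw [abs_lt]; constructor <;> linarith
  · intro x hx
    have := l4 (x - t + s1) ⟨by linarith [hx.1], by linarith [hx.2]⟩
    simp only [hF] at this
    rwa [show t + (x - t + s1 - s1) = x by ring] at this
  · have q1 := hcl l ⟨by linarith, by linarith⟩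
    have q2 := he1' (x := l) (by rw [Real.dist_eq, abs_lt]; constructor <;> linarith)
    rw [dist_eq_norm] at q2
    calc _ = ‖(p (t + (l - s1)) - ζ l) + (ζ l - ζ s1)‖ := by ring_nf
      _ ≤ _ := norm_add_le _ _
      _ < ε := by linarith

open Set Filter Topology MeasureTheory Bornology

lemma pb_lower {K : Set ℝ} (hK : IsCompact K) {f : ℝ → ℝ} (hf : Continuous f)
    (hpos : ∀ x ∈ K, 0 < f x) : ∃ d > 0, ∀ x ∈ K, d ≤ f x := by
  rcases K.eq_empty_or_nonempty with h | h
  · exact ⟨1, one_pos, by simp [h]⟩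
  · obtain ⟨x, hx, hx'⟩ := hK.exists_isMinOn h hf.continuousOn
    exact ⟨f x, hpos x hx, fun y hy => hx' hy⟩

lemma pb_seg_ball {a b c z : ℂ} {d : ℝ} (ha : ‖a - z‖ < d) (hb : ‖b - z‖ < d)
    (hc : c ∈ segment ℝ a b) : ‖c - z‖ < d := by
  have := (convex_ball z d).segment_subset (x := a) (y := b) (by simpa [dist_eq_norm] using ha)
    (by simpa [dist_eq_norm] using hb) hc
  simpa [dist_eq_norm] using this

lemma pb_planar_aux (p ζ : ℝ → ℂ) (hp : Continuous p) (hζ : Continuous ζ) (M : ℝ) (hM : 0 < M)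
    (hinj : ∀ s s', 0 < |s - s'| → |s - s'| ≤ M → ζ s ≠ ζ s')
    (D1 : ∀ s0, ∀ η > 0, ∃ ρ > 0, ∃ T, ∀ t ≥ T, ‖p t - ζ s0‖ < ρ → ∀ s, |s| ≤ M →
      ‖p (t + s) - ζ (s0 + s)‖ < η)
    (D2 : ∀ ε0 > 0, ∃ T, ∀ t ≥ T, ∀ s ≥ ε0, p t ≠ p (t + s))
    (D3 : ∀ s0, ∀ ρ > 0, ∀ T, ∃ t ≥ T, ‖p t - ζ s0‖ < ρ)
    (h0 : (ζ 0).re < (ζ (M / 8)).re) :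
    ∃ s1, ∃ ρ2 > 0, ∀ ε > 0, ∃ T, ∀ t ≥ T, ‖p t - ζ s1‖ < ρ2 →
      ∃ l, |l - t| ≤ M ∧ ‖p l - ζ s1‖ < ε := by
  obtain ⟨s1, s2, L, g1, g2, g3, g4, g5, g6, g7, g8⟩ := pb_tilt (f := fun s => (ζ s).re)
    (by fun_prop) (a := 0) (b := M / 8) (by linarith) h0
  have ExP := pb_exp p ζ hp hζ M 0 (M/8) s1 s2 L g1 g2 g3 (by linarith) g4 g5 g6 g7 g8 D1
  set c1 := (ζ s1).re with hc1
  set c2 := (ζ s2).re with hc2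
  have hc : c1 < c2 := by
    have := g6 s2 ⟨g2.le, le_rfl⟩
    nlinarith [mul_pos g4 (sub_pos.2 g2)]
  set τ := s2 - s1 with hτ
  have hτ0 : 0 < τ := by linarith
  have hτM : τ < M / 8 := by linarith
  set κ := τ / 8 with hκ
  have hκ0 : 0 < κ := by linarith
  obtain ⟨d1, hd1, hd1'⟩ := pb_lower (K := Icc (-(M/2)) (-κ) ∪ Icc κ (M/2))
    (isCompact_Icc.union isCompact_Icc) (f := fun s => ‖ζ (s1 + s) - ζ s1‖) (by fun_prop) (by
      intro s hs
      rw [norm_sub_pos_iff]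
      apply hinj
      · rw [add_sub_cancel_left, abs_pos]; rintro rfl
        rcases hs with h | h <;> linarith [h.1, h.2]
      · rw [add_sub_cancel_left, abs_le]
        rcases hs with h | h <;> constructor <;> linarith [h.1, h.2])
  obtain ⟨d2a, hd2a, hd2a'⟩ := pb_lower (K := Icc 0 τ)
    isCompact_Icc (f := fun s => ‖ζ (s1 - κ) - ζ (s1 + s)‖) (by fun_prop) (by
      intro s hs
      rw [norm_sub_pos_iff]
      apply hinj
      · rw [abs_pos]; intro h; linarith [hs.1]
      · rw [abs_le]; constructor <;> linarith [hs.1, hs.2])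
  obtain ⟨d2b, hd2b, hd2b'⟩ := pb_lower (K := Icc 0 κ)
    isCompact_Icc (f := fun s => ‖ζ (s1 - s) - ζ s2‖) (by fun_prop) (by
      intro s hs
      rw [norm_sub_pos_iff]
      apply hinj
      · rw [abs_pos]; intro h; linarith [hs.1]
      · rw [abs_le]; constructor <;> linarith [hs.1, hs.2])
  set d2 := min d2a d2b with hd2
  have hd2p : 0 < d2 := lt_min hd2a hd2b
  have d2le1 : d2 ≤ d2a := min_le_left _ _
  have d2le2 : d2 ≤ d2b := min_le_right _ _
  obtain ⟨κ', hκ', hκκ, hosc⟩ : ∃ κ' > 0, κ' ≤ κ ∧ ∀ x ∈ Icc (s1 - M) (s1 + M),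
      ∀ y ∈ Icc (s1 - M) (s1 + M), |x - y| < 2 * κ' → ‖ζ x - ζ y‖ < d2 / 4 := by
    have huc := (isCompact_Icc (a := s1 - M) (b := s1 + M)).uniformContinuousOn_of_continuous
      hζ.continuousOn
    rw [Metric.uniformContinuousOn_iff] at huc
    obtain ⟨e, he, he'⟩ := huc (d2/4) (by linarith)
    refine ⟨min κ (e/2), lt_min hκ0 (by linarith), min_le_left _ _, fun x hx y hy hxy => ?_⟩
    have := he' x hx y hy (by rw [Real.dist_eq]; linarith [min_le_right κ (e/2)])
    rwa [dist_eq_norm] at this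
  set η := min (d1 / 2) (d2 / 4) / 2 with hη
  have hmin : 0 < min (d1 / 2) (d2 / 4) := lt_min (by linarith) (by linarith)
  have hη0 : 0 < η := by linarith
  have hηd1 : 2 * η < d1 := by linarith [min_le_left (d1/2) (d2/4)]
  have hηd2 : η < d2 / 4 := by linarith [min_le_right (d1/2) (d2/4)]
  obtain ⟨ρ1, hρ1, T1, hT1⟩ := D1 s1 η hη0
  set ρ' := min ρ1 η with hρ'
  have hρ'0 : 0 < ρ' := lt_min hρ1 hη0
  have hρ'η : ρ' ≤ η := min_le_right _ _
  have hρ'1 : ρ' ≤ ρ1 := min_le_left _ _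
  set e := min κ (min κ' ρ') with he
  have he0 : 0 < e := lt_min hκ0 (lt_min hκ' hρ'0)
  have heκ : e ≤ κ := min_le_left _ _
  have heκ' : e ≤ κ' := (min_le_right _ _).trans (min_le_left _ _)
  have heρ' : e ≤ ρ' := (min_le_right _ _).trans (min_le_right _ _)
  obtain ⟨ρE, hρE, TE, hTE⟩ := ExP e he0
  obtain ⟨TD, hTD⟩ := D2 (M/8) (by linarith)
  set Tm := max T1 (max TE TD) with hTm
  have hTm1 : T1 ≤ Tm := le_max_left _ _
  have hTmE : TE ≤ Tm := (le_max_left _ _).trans (le_max_right _ _)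
  have hTmD : TD ≤ Tm := (le_max_right _ _).trans (le_max_right _ _)
  set ρ := min ρE ρ' with hρ
  have hρ0 : 0 < ρ := lt_min hρE hρ'0
  set S : Set ℝ := {l | Tm ≤ l ∧ (∃ r, pbUp p c1 c2 l r ∧ |r - l - τ| < 2 * κ') ∧
    ‖p l - ζ s1‖ < ρ'} with hS
  have cl : ∀ l ∈ S, ∀ s, |s| ≤ M → ‖p (l + s) - ζ (s1 + s)‖ < η := fun l hl s hs =>
    hT1 l (hTm1.trans hl.1) (hl.2.2.trans_le hρ'1) s hs
  have hSsep : ∀ x ∈ S, ∀ y ∈ S, |x - y| < M / 2 → x = y := by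
    have key : ∀ x ∈ S, ∀ y ∈ S, x < y → y - x < M / 2 → False := by
      intro x hx y hy hxy hlt
      have q1 := cl x hx (y - x) (by rw [abs_of_pos (by linarith)]; linarith)
      rw [add_sub_cancel] at q1
      have q2 := hy.2.2
      have q3 : ‖ζ (s1 + (y - x)) - ζ s1‖ < d1 := by
        calc _ = ‖(p y - ζ s1) - (p y - ζ (s1 + (y - x)))‖ := by ring_nf
          _ ≤ _ := norm_sub_le _ _
          _ < d1 := by linarith
      have q4 : y - x < κ := by
        by_contra hcon
        push Not at hcon
        have := hd1' (y - x) (Or.inr ⟨hcon, hlt.le⟩)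
        linarith
      obtain ⟨r, hr1, hr2⟩ := hx.2.1
      have hr2' := abs_lt.1 hr2
      have := hr1.2.2.2 y ⟨hxy, by linarith [hr2'.1]⟩
      obtain ⟨r', hr1', -⟩ := hy.2.1
      linarith [hr1'.2.1]
    intro x hx y hy hxy
    rcases lt_trichotomy x y with h | h | h
    · rw [abs_sub_comm, abs_of_pos (by linarith)] at hxy
      exact (key x hx y hy h hxy).elim
    · exact h
    · rw [abs_of_pos (by linarith)] at hxy
      exact (key y hy x hx h hxy).elim
  have ExS : ∀ e' > 0, ∃ ρ > 0, ∃ T, ∀ t ≥ T, ‖p t - ζ s1‖ < ρ → ∃ l ∈ S, |l - t| < e' ∧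
      ‖p l - ζ s1‖ < e' := by
    intro e' he'
    obtain ⟨ρ3, hρ3, T3, hT3⟩ := ExP (min e' e) (lt_min he' he0)
    have m1 := min_le_left e' e
    have m2 := min_le_right e' e
    refine ⟨ρ3, hρ3, max T3 (Tm + e'), fun t ht hpt => ?_⟩
    obtain ⟨l, r, u1, u2, u3, u4⟩ := hT3 t ((le_max_left _ _).trans ht) hpt
    have ht2 : Tm + e' ≤ t := (le_max_right _ _).trans ht
    have u1' := abs_lt.1 u1
    exact ⟨l, ⟨by linarith, ⟨r, u3, by linarith⟩, by linarith⟩, by linarith, by linarith⟩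
  have hSub : ∀ e' > 0, ∀ a, ∃ x ∈ S, a < x ∧ ‖p x - ζ s1‖ < e' := by
    intro e' he' a
    obtain ⟨ρ3, hρ3, T3, hT3⟩ := ExS e' he'
    obtain ⟨t, ht, ht'⟩ := D3 s1 ρ3 hρ3 (max T3 (a + e'))
    obtain ⟨l, l1, l2, l3⟩ := hT3 t ((le_max_left _ _).trans ht) ht'
    have := (le_max_right _ _).trans ht
    exact ⟨l, l1, by linarith [(abs_lt.1 l2).1], l3⟩
  obtain ⟨l, lS, lsep, lsurj⟩ := pb_enum S (M/2) Tm (by linarith) (fun x hx => hx.1) hSsep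
    (fun a => by obtain ⟨x, h1, h2, -⟩ := hSub 1 one_pos a; exact ⟨x, h1, h2⟩)
  have hl_lt : ∀ i j, l i < l j → i < j := by
    intro i j hij
    by_contra hcon
    rcases (not_lt.1 hcon).lt_or_eq with h | h
    · linarith [lsep j i h]
    · rw [h] at hij; exact lt_irrefl _ hij
  have hr := fun n => (lS n).2.1
  choose r hr1 hr2 using hr
  have hre : ∀ n, (p (l n)).re = c1 := fun n => (hr1 n).2.1
  have hnorm : ∀ n, ‖p (l n) - ζ s1‖ = |(p (l n)).im - (ζ s1).im| := by
    intro n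
    have : p (l n) - ζ s1 = (((p (l n)).im - (ζ s1).im : ℝ) : ℂ) * Complex.I := by
      apply Complex.ext <;> simp [hre, hc1]
    rw [this]; simp only [norm_mul, Complex.norm_I, mul_one, Complex.norm_real, Real.norm_eq_abs]
  set P : ℕ → Prop := fun n => ‖p (l n) - ζ s1‖ < ρ with hP
  have freq : ∀ e' > 0, ∀ N, ∃ n > N, ‖p (l n) - ζ s1‖ < e' := by
    intro e' he' N
    obtain ⟨x, hx, hx1, hx2⟩ := hSub e' he' (l N)
    obtain ⟨n, rfl⟩ := lsurj x hx
    exact ⟨n, hl_lt _ _ hx1, hx2⟩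
  have hinf : {k | P k}.Infinite := by
    rw [Set.infinite_iff_exists_gt]
    intro N
    obtain ⟨n, h1, h2⟩ := freq ρ hρ0 N
    exact ⟨n, h2, h1⟩
  have hneD : ∀ t t', Tm ≤ t → t + M / 8 ≤ t' → p t ≠ p t' := by
    intro t t' h1 h2
    have := hTD t (hTmD.trans h1) (t' - t) (by show M / 8 ≤ _; linarith)
    rwa [add_sub_cancel] at this
  have hrl : ∀ n, τ - 2 * κ' < r n - l n ∧ r n - l n < τ + 2 * κ' := by
    intro n
    have := abs_lt.1 (hr2 n)
    constructor <;> linarith [this.1, this.2]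
  have lag := pb_planar_core p hp Tm (M/8) (by linarith) hneD l r c1 c2 hc (fun n => (lS n).1)
    (fun n => (hr1 n).1.le) (fun i j hij => by linarith [lsep i j hij, (hrl i).2])
    hre (fun n => (hr1 n).2.2.1) (fun n t ht => by
      rcases ht.1.lt_or_eq with h | h
      · exact ((hr1 n).2.2.2 t ⟨h, ht.2⟩).le
      · rw [← h, hre n]) P hinf (by
      intro n n' k hn hn' hk
      simp only [hP] at hn hn' hk
      rw [hnorm] at hn hn' hk
      rw [not_lt, le_abs] at hk
      rw [abs_lt] at hn hn'
      rcases hk with hk | hk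
      · constructor <;> intro <;> linarith [hn.1, hn.2, hn'.1, hn'.2]
      · constructor <;> intro <;> linarith [hn.1, hn.2, hn'.1, hn'.2]) (by
      intro n n' m hn hn' hor
      have hm1 := lsep m (m+1) (by omega)
      have hclose : ∀ k, ∀ σ ∈ Icc (0:ℝ) 1,
          ‖p (l k + σ * (r k - l k)) - ζ (s1 + σ * τ)‖ < d2 / 2 := by
        intro k σ hσ
        have b1 : 0 ≤ σ * (r k - l k) := mul_nonneg hσ.1 (by linarith [(hrl k).1])
        have b2 : σ * (r k - l k) ≤ 1 * (r k - l k) :=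
          mul_le_mul_of_nonneg_right hσ.2 (by linarith [(hrl k).1])
        have b3 : 0 ≤ σ * τ := mul_nonneg hσ.1 hτ0.le
        have b4 : σ * τ ≤ 1 * τ := mul_le_mul_of_nonneg_right hσ.2 hτ0.le
        have a1 := cl (l k) (lS k) (σ * (r k - l k)) (by
          rw [abs_of_nonneg b1]; linarith [(hrl k).2])
        have a2 := hosc (s1 + σ * (r k - l k)) ⟨by linarith, by linarith [(hrl k).2]⟩
          (s1 + σ * τ) ⟨by linarith, by linarith⟩ (by
            rw [show s1 + σ * (r k - l k) - (s1 + σ * τ) = σ * (r k - l k - τ) by ring, abs_mul,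
              abs_of_nonneg hσ.1]
            have := mul_le_mul_of_nonneg_right hσ.2 (abs_nonneg (r k - l k - τ))
            linarith [hr2 k])
        calc _ = ‖(p (l k + σ * (r k - l k)) - ζ (s1 + σ * (r k - l k))) +
              (ζ (s1 + σ * (r k - l k)) - ζ (s1 + σ * τ))‖ := by ring_nf
          _ ≤ _ := norm_add_le _ _
          _ < d2 / 2 := by linarith
      refine ⟨l (m+1) - κ, by linarith [(hrl m).2], by linarith, ?_, ?_, ?_⟩
      · intro t ht hmem
        have hlt := pb_seg_ball hn hn' hmem
        have ht0 : Tm ≤ t := by linarith [(lS m).1, ht.1, (hr1 m).1]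
        obtain ⟨x, y, v1, v2, v3, v4⟩ := hTE t (hTmE.trans ht0)
          (hlt.trans_le (min_le_left _ _))
        have v1' := abs_lt.1 v1
        have hx1 : l m < x := by linarith [ht.1, (hrl m).1]
        have hx2 : x < l (m+1) := by linarith [ht.2]
        have hxS : x ∈ S := ⟨by linarith [(lS m).1], ⟨y, v3, by linarith⟩, by linarith⟩
        obtain ⟨k, rfl⟩ := lsurj x hxS
        have := hl_lt _ _ hx1
        have := hl_lt _ _ hx2
        omega
      · intro σ hσ hmem
        have h1 := pb_seg_ball (hclose n σ hσ) (hclose n' σ hσ) hmem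
        have h2 := cl _ (lS (m+1)) (-κ) (by rw [abs_neg, abs_of_pos hκ0]; linarith)
        have h3 := hd2a' (σ * τ) ⟨mul_nonneg hσ.1 hτ0.le, by nlinarith [hσ.2]⟩
        rw [← sub_eq_add_neg, ← sub_eq_add_neg] at h2
        have h4 : ‖ζ (s1 - κ) - ζ (s1 + σ * τ)‖ < d2 := by
          calc _ = ‖(p (l (m+1) - κ) - ζ (s1 + σ * τ)) - (p (l (m+1) - κ) - ζ (s1 - κ))‖ := by
                ring_nf
            _ ≤ _ := norm_sub_le _ _
            _ < d2 := by linarith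
        linarith
      · intro t ht hmem
        have o1 := hclose n 1 ⟨by norm_num, le_rfl⟩
        have o2 := hclose n' 1 ⟨by norm_num, le_rfl⟩
        rw [one_mul, one_mul, add_sub_cancel, show s1 + τ = s2 by rw [hτ]; ring] at o1 o2
        have h1 := pb_seg_ball o1 o2 hmem
        have h2 := cl _ (lS (m+1)) (t - l (m+1)) (by
          rw [abs_le]; constructor <;> linarith [ht.1, ht.2])
        have h3 := hd2b' (l (m+1) - t) ⟨by linarith [ht.2], by linarith [ht.1]⟩
        rw [add_sub_cancel, show s1 + (t - l (m+1)) = s1 - (l (m+1) - t) by ring] at h2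
        have h4 : ‖ζ (s1 - (l (m+1) - t)) - ζ s2‖ < d2 := by
          calc _ = ‖(p t - ζ s2) - (p t - ζ (s1 - (l (m+1) - t)))‖ := by
                ring_nf
            _ ≤ _ := norm_sub_le _ _
            _ < d2 := by linarith
        linarith)
  have gm : StrictMono (Nat.nth P) := Nat.nth_strictMono hinf
  have gP : ∀ n, P n → ∃ k, Nat.nth P k = n := by
    intro n hn
    have h4 : n ∈ Set.range (Nat.nth P) := by
      rw [Nat.range_nth_of_infinite hinf]; exact hn
    exact h4
  have conv := pb_seq_conv (fun n => (p (l (Nat.nth P n))).im) (ζ s1).im (by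
      intro i j hij heq
      have hne : Nat.nth P i ≠ Nat.nth P j := fun h => hij (gm.injective h)
      have hpe : p (l (Nat.nth P i)) = p (l (Nat.nth P j)) := by
        apply Complex.ext
        · rw [hre, hre]
        · exact heq
      rcases lt_or_gt_of_ne hne with h | h
      · exact hneD _ _ (lS _).1 (by linarith [lsep _ _ h]) hpe
      · exact hneD _ _ (lS _).1 (by linarith [lsep _ _ h]) hpe.symm) lag (by
      intro e' he' N
      obtain ⟨n, h1, h2⟩ := freq (min ρ e') (lt_min hρ0 he') (Nat.nth P N)
      obtain ⟨k, rfl⟩ := gP n (h2.trans_le (min_le_left _ _))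
      refine ⟨k, (gm.lt_iff_lt.1 h1).le, ?_⟩
      rw [← hnorm]
      exact h2.trans_le (min_le_right _ _))
  obtain ⟨ρ2, hρ2, T2, hT2⟩ := ExS (min ρ M) (lt_min hρ0 hM)
  refine ⟨s1, ρ2, hρ2, fun ε hε => ?_⟩
  obtain ⟨N, hN⟩ := conv ε hε
  refine ⟨max T2 (l (Nat.nth P N) + M), fun t ht hpt => ?_⟩
  obtain ⟨x, hx, hx1, hx2⟩ := hT2 t ((le_max_left _ _).trans ht) hpt
  have ht2 := (le_max_right _ _).trans ht
  have hxM : |x - t| < M := hx1.trans_le (min_le_right _ _)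
  obtain ⟨n, rfl⟩ := lsurj x hx
  obtain ⟨k, rfl⟩ := gP n (hx2.trans_le (min_le_left _ _))
  have hk : l (Nat.nth P N) < l (Nat.nth P k) := by linarith [(abs_lt.1 hxM).1]
  refine ⟨_, hxM.le, ?_⟩
  rw [hnorm]
  exact hN k (gm.lt_iff_lt.1 (hl_lt _ _ hk)).le

theorem pb_planar (p ζ : ℝ → ℂ) (hp : Continuous p) (hζ : Continuous ζ) (M : ℝ) (hM : 0 < M)
    (hinj : ∀ s s', 0 < |s - s'| → |s - s'| ≤ M → ζ s ≠ ζ s')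
    (D1 : ∀ s0, ∀ η > 0, ∃ ρ > 0, ∃ T, ∀ t ≥ T, ‖p t - ζ s0‖ < ρ → ∀ s, |s| ≤ M →
      ‖p (t + s) - ζ (s0 + s)‖ < η)
    (D2 : ∀ ε0 > 0, ∃ T, ∀ t ≥ T, ∀ s ≥ ε0, p t ≠ p (t + s))
    (D3 : ∀ s0, ∀ ρ > 0, ∀ T, ∃ t ≥ T, ‖p t - ζ s0‖ < ρ) :
    ∃ s1, ∃ ρ2 > 0, ∀ ε > 0, ∃ T, ∀ t ≥ T, ‖p t - ζ s1‖ < ρ2 →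
      ∃ l, |l - t| ≤ M ∧ ‖p l - ζ s1‖ < ε := by
  set d := ζ (M / 8) - ζ 0 with hd
  have hd0 : d ≠ 0 := by
    rw [hd, sub_ne_zero]
    apply hinj
    · rw [sub_zero, abs_pos]; linarith
    · rw [sub_zero, abs_of_pos (by linarith)]; linarith
  have hdn : 0 < ‖d‖ := norm_pos_iff.2 hd0
  set c : ℂ := (starRingEnd ℂ) d / (‖d‖ : ℂ) with hc
  have hcn : ‖c‖ = 1 := by
    rw [hc, norm_div]; simp [hdn.ne']
  have hc0 : c ≠ 0 := by rintro h; rw [h] at hcn; simp at hcn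
  have hcd : (c * d).re = ‖d‖ := by
    have : c * d = (‖d‖ : ℂ) := by
      rw [hc, div_mul_eq_mul_div, mul_comm, Complex.mul_conj, Complex.normSq_eq_norm_sq]
      push_cast
      field_simp
    rw [this]; simp
  have hmul : ∀ a b : ℂ, ‖c * a - c * b‖ = ‖a - b‖ := by
    intro a b; rw [← mul_sub, norm_mul, hcn, one_mul]
  have := pb_planar_aux (fun t => c * p t) (fun t => c * ζ t) (by fun_prop) (by fun_prop) M hM
    (fun s s' h1 h2 h => hinj s s' h1 h2 (mul_left_cancel₀ hc0 h))
    (by simpa only [hmul] using D1)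
    (fun ε0 h0 => by
      obtain ⟨T, hT⟩ := D2 ε0 h0
      exact ⟨T, fun t ht s hs h => hT t ht s hs (mul_left_cancel₀ hc0 h)⟩)
    (by simpa only [hmul] using D3)
    (by
      have : (c * ζ (M / 8)).re - (c * ζ 0).re = ‖d‖ := by
        rw [← Complex.sub_re, ← mul_sub]; exact hcd
      linarith)
  simpa only [hmul] using this


section basics
variable {E : Type*} [NormedAddCommGroup E] [NormedSpace ℝ E]

lemma sf_tendsto (φ : Semiflow E) {α : Type*} {l : Filter α} {t : α → ℝ} {v : α → E} {t0 : ℝ}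
    {v0 : E} (ht : Tendsto t l (𝓝 t0)) (hv : Tendsto v l (𝓝 v0)) (h : ∀ a, 0 ≤ t a)
    (h0 : 0 ≤ t0) : Tendsto (fun a => φ.toFun (t a) (v a)) l (𝓝 (φ.toFun t0 v0)) := by
  have hc := φ.continuousOn' (t0, v0) ⟨h0, mem_univ _⟩
  have : Tendsto (fun a => (t a, v a)) l (𝓝[Set.Ici (0 : ℝ) ×ˢ Set.univ] (t0, v0)) := by
    rw [tendsto_nhdsWithin_iff]
    exact ⟨ht.prodMk_nhds hv, Eventually.of_forall fun a => ⟨h a, mem_univ _⟩⟩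
  exact hc.tendsto.comp this

lemma sf_path (φ : Semiflow E) (y : E) : Continuous fun t => φ.toFun (max t 0) y := by
  rw [continuous_iff_continuousAt]
  intro t
  exact sf_tendsto φ (l := 𝓝 t) (t := fun t => max t 0) (v := fun _ => y)
    (Continuous.tendsto (by fun_prop) t) tendsto_const_nhds
    (fun a => le_max_right _ _) (le_max_right _ _)

lemma sf_cont (φ : Semiflow E) {t : ℝ} (ht : 0 ≤ t) : Continuous (φ.toFun t) := by
  rw [continuous_iff_continuousAt]
  intro v
  exact sf_tendsto φ (l := 𝓝 v) (t := fun _ => t) (v := fun v => v) tendsto_const_nhds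
    tendsto_id (fun _ => ht) ht

/-- the tail of the orbit is in a compact set -/
def pbTail (φ : Semiflow E) (y : E) : Prop :=
  ∃ C, IsCompact C ∧ ∃ T, 0 ≤ T ∧ ∀ t ≥ T, φ.toFun t y ∈ C

lemma om_mem_iff (φ : Semiflow E) (y k : E) : k ∈ φ.omegaLimit y ↔
    ∀ ε > 0, ∀ s ≥ (0:ℝ), ∃ t ≥ s, dist (φ.toFun t y) k < ε := by
  unfold Semiflow.omegaLimit
  simp only [mem_iInter, Metric.mem_closure_iff]
  constructor
  · intro h ε hε s hs
    obtain ⟨b, ⟨t, ht, rfl⟩, hb⟩ := h s hs ε hε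
    exact ⟨t, ht, by rwa [dist_comm]⟩
  · intro h s hs ε hε
    obtain ⟨t, ht, hb⟩ := h ε hε s hs
    exact ⟨_, ⟨t, ht, rfl⟩, by rwa [dist_comm]⟩

lemma om_of_seq (φ : Semiflow E) {y k : E} {t : ℕ → ℝ} (ht : Tendsto t atTop atTop)
    (hk : Tendsto (fun n => φ.toFun (t n) y) atTop (𝓝 k)) : k ∈ φ.omegaLimit y := by
  rw [om_mem_iff]
  intro ε hε s hs
  obtain ⟨n, h1, h2⟩ := ((ht.eventually_ge_atTop s).and (Metric.tendsto_nhds.1 hk ε hε)).exists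
  exact ⟨t n, h1, h2⟩

lemma om_seq (φ : Semiflow E) {y k : E} (hk : k ∈ φ.omegaLimit y) : ∃ t : ℕ → ℝ,
    (∀ n : ℕ, (n : ℝ) ≤ t n) ∧ Tendsto t atTop atTop ∧
    Tendsto (fun n => φ.toFun (t n) y) atTop (𝓝 k) := by
  rw [om_mem_iff] at hk
  have : ∀ n : ℕ, ∃ t ≥ (n : ℝ), dist (φ.toFun t y) k < 1 / ((n:ℝ) + 1) := fun n =>
    hk _ (by positivity) n (by positivity)
  choose t h1 h2 using this
  refine ⟨t, h1, tendsto_atTop_mono h1 tendsto_natCast_atTop_atTop, ?_⟩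
  rw [tendsto_iff_dist_tendsto_zero]
  exact squeeze_zero (fun n => dist_nonneg) (fun n => (h2 n).le) tendsto_one_div_add_atTop_nhds_zero_nat

lemma om_subseq (φ : Semiflow E) {y : E} (hy : pbTail φ y) {t : ℕ → ℝ}
    (ht : Tendsto t atTop atTop) : ∃ k ∈ φ.omegaLimit y, ∃ ψ : ℕ → ℕ, StrictMono ψ ∧
    Tendsto (fun n => φ.toFun (t (ψ n)) y) atTop (𝓝 k) := by
  obtain ⟨C, hC, T, hT, h⟩ := hy
  have hev := (ht.eventually_ge_atTop T)
  obtain ⟨k, -, ψ, hψ, hk⟩ := hC.tendsto_subseq' (x := fun n => φ.toFun (t n) y)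
    (hev.mono fun n hn => h _ hn).frequently
  exact ⟨k, om_of_seq φ (t := t ∘ ψ) (ht.comp hψ.tendsto_atTop) hk, ψ, hψ, hk⟩

lemma om_nonempty (φ : Semiflow E) {y : E} (hy : pbTail φ y) : (φ.omegaLimit y).Nonempty := by
  obtain ⟨k, hk, -⟩ := om_subseq φ hy tendsto_natCast_atTop_atTop
  exact ⟨k, hk⟩

lemma om_compact (φ : Semiflow E) {y : E} (hy : pbTail φ y) : IsCompact (φ.omegaLimit y) := by
  obtain ⟨C, hC, T, hT, h⟩ := hy
  refine hC.of_isClosed_subset ?_ ?_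
  · exact isClosed_biInter fun s _ => isClosed_closure
  · intro k hk
    have : k ∈ closure {w | ∃ t, T ≤ t ∧ φ.toFun t y = w} := by
      have := mem_iInter₂.1 hk T hT
      exact this
    have h2 : closure {w | ∃ t, T ≤ t ∧ φ.toFun t y = w} ⊆ C := by
      apply hC.isClosed.closure_subset_iff.2
      rintro _ ⟨t, ht, rfl⟩
      exact h t ht
    exact h2 this

lemma om_fwd (φ : Semiflow E) {y k : E} (hk : k ∈ φ.omegaLimit y) {s : ℝ} (hs : 0 ≤ s) :
    φ.toFun s k ∈ φ.omegaLimit y := by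
  obtain ⟨t, h1, h2, h3⟩ := om_seq φ hk
  apply om_of_seq φ (t := fun n => s + t n) (tendsto_atTop_add_const_left _ _ h2)
  have := ((sf_cont φ hs).tendsto k).comp h3
  refine this.congr fun n => ?_
  simp only [Function.comp]
  rw [φ.map_add' s (t n) hs ((Nat.cast_nonneg n).trans (h1 n))]

lemma om_bwd (φ : Semiflow E) {y k : E} (hy : pbTail φ y) (hk : k ∈ φ.omegaLimit y) {s : ℝ}
    (hs : 0 ≤ s) : ∃ k' ∈ φ.omegaLimit y, φ.toFun s k' = k := by
  obtain ⟨t, h1, h2, h3⟩ := om_seq φ hk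
  have h4 : Tendsto (fun n => t n - s) atTop atTop := tendsto_atTop_add_const_right _ (-s) h2
  obtain ⟨k', hk', ψ, hψ, hc⟩ := om_subseq φ hy h4
  refine ⟨k', hk', ?_⟩
  have h5 := ((sf_cont φ hs).tendsto k').comp hc
  refine tendsto_nhds_unique (h5.congr' ?_) (h3.comp hψ.tendsto_atTop)
  filter_upwards [(h4.comp hψ.tendsto_atTop).eventually_ge_atTop 0] with n hn
  simp only [Function.comp] at hn ⊢
  rw [← φ.map_add' s _ hs hn, add_sub_cancel]

/-- eventually in a neighbourhood of the omega limit set -/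
lemma om_nbhd (φ : Semiflow E) {y : E} (hy : pbTail φ y) {U : Set E} (hU : IsOpen U)
    (hK : φ.omegaLimit y ⊆ U) : ∃ T ≥ 0, ∀ t ≥ T, φ.toFun t y ∈ U := by
  by_contra hcon
  push Not at hcon
  choose t h1 h2 using fun n : ℕ => hcon n (Nat.cast_nonneg n)
  obtain ⟨k, hk, ψ, hψ, hc⟩ := om_subseq φ hy
    (tendsto_atTop_mono h1 tendsto_natCast_atTop_atTop)
  obtain ⟨n, hn⟩ := (hc.eventually (hU.mem_nhds (hK hk))).exists
  exact h2 _ hn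

/-- complete trajectories through the points of a negatively invariant set -/
lemma ct_exists (φ : Semiflow E) {K : Set E} (hf : ∀ k ∈ K, ∀ s ≥ 0, φ.toFun s k ∈ K)
    (hb : ∀ k ∈ K, ∀ s ≥ 0, ∃ k' ∈ K, φ.toFun s k' = k) {k : E} (hk : k ∈ K) :
    ∃ v : ℝ → E, φ.IsCompleteTrajectory v ∧ (∀ s, v s ∈ K) ∧ v 0 = k := by
  choose! B hB1 hB2 using fun k (hk : k ∈ K) => hb k hk 1 zero_le_one
  set q : ℕ → E := fun n => B^[n] k with hq
  have qK : ∀ n, q n ∈ K := by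
    intro n
    induction n with
    | zero => exact hk
    | succ n ih => simp only [hq, Function.iterate_succ', Function.comp]; exact hB1 _ ih
  have qs : ∀ n, φ.toFun 1 (q (n+1)) = q n := by
    intro n
    simp only [hq, Function.iterate_succ', Function.comp]
    exact hB2 _ (qK n)
  have step : ∀ (s : ℝ) (n : ℕ), 0 ≤ s + n → ∀ j : ℕ, φ.toFun (s + (n + j : ℕ)) (q (n + j)) =
      φ.toFun (s + n) (q n) := by
    intro s n hs j
    induction j with
    | zero => simp
    | succ j ih =>
      rw [← ih, ← qs (n + j), ← φ.map_add' _ _ (by push_cast; linarith [Nat.cast_nonneg (α := ℝ) j]) zero_le_one]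
      push_cast
      ring_nf
  have indep : ∀ (s : ℝ) (n m : ℕ), 0 ≤ s + n → 0 ≤ s + m →
      φ.toFun (s + n) (q n) = φ.toFun (s + m) (q m) := by
    intro s n m h1 h2
    rcases le_total n m with h | h
    · have := step s n h1 (m - n)
      rw [Nat.add_sub_cancel' h] at this
      exact this.symm
    · have := step s m h2 (n - m)
      rw [Nat.add_sub_cancel' h] at this
      exact this
  have hN : ∀ s : ℝ, 0 ≤ s + ⌈|s|⌉₊ := fun s => by
    linarith [Nat.le_ceil |s|, neg_abs_le s]
  set v : ℝ → E := fun s => φ.toFun (s + ⌈|s|⌉₊) (q ⌈|s|⌉₊) with hv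
  have hvn : ∀ (s : ℝ) (n : ℕ), 0 ≤ s + n → v s = φ.toFun (s + n) (q n) := fun s n h =>
    indep s _ n (hN s) h
  refine ⟨v, ⟨?_, ?_⟩, ?_, ?_⟩
  · rw [continuous_iff_continuousAt]
    intro s
    set n := ⌈|s| + 1⌉₊ with hn
    have h1 : |s| + 1 ≤ n := Nat.le_ceil _
    have hc : ContinuousAt (fun s' => φ.toFun (max (s' + n) 0) (q n)) s :=
      ((sf_path φ (q n)).comp (continuous_add_const (n:ℝ))).continuousAt
    apply hc.congr
    filter_upwards [Ioi_mem_nhds (show s - 1 < s by linarith)] with s' hs'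
    have h2 : 0 ≤ s' + n := by
      have : s - 1 < s' := hs'
      linarith [neg_abs_le s]
    rw [max_eq_left h2, hvn s' n h2]
  · intro t ht s
    rw [hvn s _ (hN s), hvn (t + s) ⌈|s|⌉₊ (by linarith [hN s]), ← φ.map_add' _ _ ht (hN s),
      add_assoc]
  · intro s
    exact hf _ (qK _) _ (hN s)
  · simp [hv, hq, φ.map_zero']

end basics


lemma pb_mean {f : ℝ → ℝ} (hf : Continuous f) {a s C : ℝ} (hs : 0 < s)
    (h : ∫ t in a..(a + s), f t ≤ C) : ∃ c ∈ Icc a (a + s), s * f c ≤ C := by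
  obtain ⟨c, hc, hc'⟩ := (isCompact_Icc (a := a) (b := a + s)).exists_isMinOn
    (nonempty_Icc.2 (by linarith)) hf.continuousOn
  refine ⟨c, hc, le_trans ?_ h⟩
  have : ∫ t in a..(a+s), f c ≤ ∫ t in a..(a+s), f t :=
    intervalIntegral.integral_mono_on (by linarith) (by simp) (hf.intervalIntegrable _ _)
      (fun x hx => hc' hx)
  simpa using this

section dyn
variable {E : Type*} [NormedAddCommGroup E] [NormedSpace ℝ E]
variable {H : Type*} [NormedAddCommGroup H] [InnerProductSpace ℝ H]

lemma pb_int_nonneg {ν : ℝ} (f : ℝ → H) {a b : ℝ} (hab : a ≤ b) :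
    0 ≤ ∫ s in a..b, Real.exp (2 * ν * s) * ‖f s‖ ^ 2 :=
  intervalIntegral.integral_nonneg hab (fun x _ => by positivity)

lemma dich_neg (ι : E →L[ℝ] H) (φ : Semiflow E) (P : E →L[ℝ] E →L[ℝ] ℝ) (δ τV ν : ℝ)
    (hH3 : φ.IsH3 ι P δ τV ν) (y1 y2 : E) {t0 t : ℝ} (h0 : 0 ≤ t0) (ht : t0 + τV ≤ t)
    (hneg : P (φ.toFun t0 y1 - φ.toFun t0 y2) (φ.toFun t0 y1 - φ.toFun t0 y2) < 0) :
    P (φ.toFun t y1 - φ.toFun t y2) (φ.toFun t y1 - φ.toFun t y2) < 0 := by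
  obtain ⟨hδ, hτ, hν, h⟩ := hH3
  have h1 := h y1 y2 t0 t h0 (by linarith) (by linarith)
  have h2 := pb_int_nonneg (ν := ν) (fun s => ι (φ.toFun s y1) - ι (φ.toFun s y2))
    (show t0 ≤ t by linarith)
  have h3 := mul_nonneg hδ.le h2
  have h4 := mul_neg_of_pos_of_neg (Real.exp_pos (2 * ν * t0)) hneg
  have h5 := Real.exp_pos (2 * ν * t)
  by_contra hcon
  have := mul_nonneg h5.le (not_lt.1 hcon)
  linarith

/-- (L1) -/
lemma ct_neg (ι : E →L[ℝ] H) (hι : Function.Injective ι) (φ : Semiflow E)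
    (P : E →L[ℝ] E →L[ℝ] ℝ) (δ τV ν : ℝ)
    (hH3 : φ.IsH3 ι P δ τV ν) {K : Set E} (hK : IsCompact K) {u v : ℝ → E}
    (hu : φ.IsCompleteTrajectory u) (hv : φ.IsCompleteTrajectory v) (huK : ∀ s, u s ∈ K)
    (hvK : ∀ s, v s ∈ K) {r0 r : ℝ} (hr : r0 ≤ r) (hne : u r0 ≠ v r0) :
    P (u r - v r) (u r - v r) < 0 := by
  obtain ⟨hδ, hτ, hν, h⟩ := hH3
  have huc := hu.1
  have hvc := hv.1
  set g : ℝ → ℝ := fun s => Real.exp (2 * ν * s) * ‖ι (u s) - ι (v s)‖ ^ 2 with hg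
  have hgc : Continuous g := by simp only [hg]; fun_prop
  have hg0 : ∀ s, 0 ≤ g s := fun s => by simp only [hg]; positivity
  set I := ∫ s in (r0 - 1)..r0, g s with hI
  have hIpos : 0 < I := by
    apply intervalIntegral.integral_pos (by linarith) hgc.continuousOn (fun x _ => hg0 x)
    refine ⟨r0, ⟨by linarith, le_rfl⟩, ?_⟩
    have : ι (u r0) - ι (v r0) ≠ 0 := sub_ne_zero.2 (fun h => hne (hι h))
    have := norm_pos_iff.2 this
    simp only [hg]
    positivity
  -- bound for V on K
  obtain ⟨C, hC⟩ : ∃ C, ∀ a ∈ K, ∀ b ∈ K, P (a - b) (a - b) ≤ C := by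
    have hc : Continuous fun x : E × E => P (x.1 - x.2) (x.1 - x.2) := by fun_prop
    obtain ⟨C, hC⟩ := (hK.prod hK).bddAbove_image hc.continuousOn
    exact ⟨C, fun a ha b hb => hC ⟨(a, b), ⟨ha, hb⟩, rfl⟩⟩
  have key : ∀ n : ℕ, τV ≤ r + n → 1 ≤ r0 + n → 
      Real.exp (2 * ν * r) * P (u r - v r) (u r - v r) ≤ Real.exp (-(2 * ν * n)) * C - δ * I := by
    intro n hn1 hn2
    have e1 : ∀ s : ℝ, 0 ≤ s → φ.toFun s (u (-n)) = u (s - n) := fun s hs => by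
      rw [sub_eq_add_neg, hu.2 s hs]
    have e2 : ∀ s : ℝ, 0 ≤ s → φ.toFun s (v (-n)) = v (s - n) := fun s hs => by
      rw [sub_eq_add_neg, hv.2 s hs]
    have h1 := h (u (-n)) (v (-n)) 0 (r + n) le_rfl (by linarith) (by linarith)
    rw [e1 _ (by linarith), e2 _ (by linarith), e1 0 le_rfl, e2 0 le_rfl] at h1
    have e3 : ∫ s in (0:ℝ)..(r + n), Real.exp (2 * ν * s) *
        ‖ι (φ.toFun s (u (-n))) - ι (φ.toFun s (v (-n)))‖ ^ 2 =
        Real.exp (2 * ν * n) * ∫ s in (-(n:ℝ))..r, g s := by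
      have e0 := intervalIntegral.integral_comp_sub_right (a := 0) (b := r + n)
        (fun s => Real.exp (2 * ν * n) * g s) (n:ℝ)
      rw [zero_sub, add_sub_cancel_right] at e0
      rw [← intervalIntegral.integral_const_mul, ← e0]
      apply intervalIntegral.integral_congr
      intro s hs
      rw [uIcc_of_le (by linarith)] at hs
      simp only [hg]
      rw [e1 s hs.1, e2 s hs.1, ← mul_assoc, ← Real.exp_add]
      ring_nf
    have e4 : I ≤ ∫ s in (-(n:ℝ))..r, g s :=
      intervalIntegral.integral_mono_interval (by linarith) (by linarith) hr
        (Eventually.of_forall hg0) (hgc.intervalIntegrable _ _)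
    rw [e3, add_sub_cancel_right] at h1
    have e5 := hC (u (0 - n)) (huK _) (v (0 - n)) (hvK _)
    have e6 : Real.exp (2 * ν * (r + n)) = Real.exp (2 * ν * n) * Real.exp (2 * ν * r) := by
      rw [← Real.exp_add]; ring_nf
    rw [e6] at h1
    simp only [mul_zero, Real.exp_zero, one_mul] at h1
    have e7 := Real.exp_pos (2 * ν * n)
    have e8 : Real.exp (2 * ν * n) * Real.exp (-(2 * ν * n)) = 1 := by
      rw [← Real.exp_add]; simp
    have e9 : δ * I ≤ δ * ∫ s in (-(n:ℝ))..r, g s := mul_le_mul_of_nonneg_left e4 hδ.le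
    have : Real.exp (2 * ν * n) * (Real.exp (2 * ν * r) * P (u r - v r) (u r - v r)) ≤
        Real.exp (2 * ν * n) * (Real.exp (-(2 * ν * n)) * C - δ * I) := by
      have e10 := mul_le_mul_of_nonneg_left e9 e7.le
      have e11 : Real.exp (2 * ν * n) * (Real.exp (-(2 * ν * n)) * C) = C := by
        rw [← mul_assoc, e8, one_mul]
      rw [mul_sub, e11]
      nlinarith
    exact le_of_mul_le_mul_left this e7
  have hlim : Tendsto (fun n : ℕ => Real.exp (-(2 * ν * n)) * C - δ * I) atTop
      (𝓝 (0 * C - δ * I)) := by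
    apply Tendsto.sub_const
    apply Tendsto.mul_const
    apply Real.tendsto_exp_atBot.comp
    apply tendsto_neg_atTop_atBot.comp
    exact tendsto_natCast_atTop_atTop.const_mul_atTop (by positivity)
  have hfin := ge_of_tendsto hlim (by
    filter_upwards [tendsto_natCast_atTop_atTop.eventually_ge_atTop (τV - r),
      tendsto_natCast_atTop_atTop.eventually_ge_atTop (1 - r0)] with n h1 h2
    exact key n (by linarith) (by linarith))
  have : 0 < δ * I := by positivity
  by_contra hcon
  have := mul_nonneg (Real.exp_pos (2 * ν * r)).le (not_lt.1 hcon)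
  linarith

lemma nonneg_bound (ι : E →L[ℝ] H) (φ : Semiflow E) (P : E →L[ℝ] E →L[ℝ] ℝ) (δ τV ν : ℝ)
    (hH3 : φ.IsH3 ι P δ τV ν) (y1 y2 : E)
    (hV : ∀ t ≥ 0, 0 ≤ P (φ.toFun t y1 - φ.toFun t y2) (φ.toFun t y1 - φ.toFun t y2)) :
    ∃ F : ℝ → ℝ, Continuous F ∧ (∀ t, 0 ≤ F t) ∧
      (∀ t ≥ 0, F t = Real.exp (2 * ν * t) * ‖ι (φ.toFun t y1) - ι (φ.toFun t y2)‖ ^ 2) ∧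
      ∃ C, ∀ a b, 0 ≤ a → a ≤ b → ∫ t in a..b, F t ≤ C := by
  obtain ⟨hδ, hτ, hν, h⟩ := hH3
  have c1 := sf_path φ y1
  have c2 := sf_path φ y2
  set F : ℝ → ℝ := fun t => Real.exp (2 * ν * t) *
    ‖ι (φ.toFun (max t 0) y1) - ι (φ.toFun (max t 0) y2)‖ ^ 2 with hF
  have hFc : Continuous F := by simp only [hF]; fun_prop
  have hF0 : ∀ t, 0 ≤ F t := fun t => by simp only [hF]; positivity
  have hFe : ∀ t ≥ 0, F t = Real.exp (2 * ν * t) * ‖ι (φ.toFun t y1) - ι (φ.toFun t y2)‖ ^ 2 := by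
    intro t ht
    simp only [hF]
    rw [max_eq_left ht]
  refine ⟨F, hFc, hF0, hFe, P (φ.toFun 0 y1 - φ.toFun 0 y2) (φ.toFun 0 y1 - φ.toFun 0 y2) / δ, ?_⟩
  intro a b ha hab
  have h1 := h y1 y2 0 (b + τV) le_rfl (by linarith) (by linarith)
  have h2 := mul_nonneg (Real.exp_pos (2 * ν * (b + τV))).le (hV (b + τV) (by show 0 ≤ _; linarith))
  have e : ∫ s in (0:ℝ)..(b + τV), Real.exp (2 * ν * s) *
      ‖ι (φ.toFun s y1) - ι (φ.toFun s y2)‖ ^ 2 = ∫ s in (0:ℝ)..(b + τV), F s := by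
    apply intervalIntegral.integral_congr
    intro s hs
    rw [uIcc_of_le (by linarith)] at hs
    exact (hFe s hs.1).symm
  rw [e] at h1
  simp only [mul_zero, Real.exp_zero, one_mul] at h1
  have h3 : ∫ t in a..b, F t ≤ ∫ s in (0:ℝ)..(b + τV), F s :=
    intervalIntegral.integral_mono_interval ha hab (by linarith)
        (Eventually.of_forall hF0) (hFc.intervalIntegrable _ _)
  rw [le_div_iff₀ hδ]
  nlinarith

lemma sm_decay (ι : E →L[ℝ] H) (φ : Semiflow E) {ν τS CS A t : ℝ} (hCS : 0 < CS) (y1 y2 : E)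
    (hτS : 0 ≤ τS) (ht : 0 ≤ t)
    (hS : ∀ v₁ v₂ : E, ‖φ.toFun τS v₁ - φ.toFun τS v₂‖ ≤ CS * ‖ι v₁ - ι v₂‖)
    (hA : Real.exp (2 * ν * t) * ‖ι (φ.toFun t y1) - ι (φ.toFun t y2)‖ ^ 2 ≤ A) :
    ‖φ.toFun (τS + t) y1 - φ.toFun (τS + t) y2‖ ≤ CS * Real.sqrt A * Real.exp (-(ν * t)) := by
  rw [φ.map_add' _ _ hτS ht, φ.map_add' _ _ hτS ht]
  refine (hS _ _).trans ?_
  rw [mul_assoc]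
  apply mul_le_mul_of_nonneg_left _ hCS.le
  set d := ‖ι (φ.toFun t y1) - ι (φ.toFun t y2)‖ with hd
  have h1 : (Real.exp (ν * t) * d) ^ 2 ≤ A := by
    refine le_trans (le_of_eq ?_) hA
    rw [mul_pow, ← Real.exp_nat_mul]
    push_cast
    ring_nf
  have h2 := Real.le_sqrt_of_sq_le h1
  rw [Real.exp_neg, ← div_eq_mul_inv, le_div_iff₀ (Real.exp_pos _)]
  linarith

lemma caseA_sub (ι : E →L[ℝ] H) (φ : Semiflow E) (P : E →L[ℝ] E →L[ℝ] ℝ) (δ τV ν : ℝ)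
    (hH3 : φ.IsH3 ι P δ τV ν) (hS : φ.IsSmoothing ι) (y1 y2 : E) (hy1 : pbTail φ y1)
    (hV : ∀ t ≥ 0, 0 ≤ P (φ.toFun t y1 - φ.toFun t y2) (φ.toFun t y1 - φ.toFun t y2)) :
    φ.omegaLimit y1 ⊆ φ.omegaLimit y2 := by
  obtain ⟨F, hFc, hF0, hFe, C, hC⟩ := nonneg_bound ι φ P δ τV ν hH3 y1 y2 hV
  obtain ⟨τS, CS, hτS, hCS, hS⟩ := hS
  have hν := hH3.2.2.1
  have good : ∀ a ≥ 0, ∃ c ∈ Icc a (a + 1),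
      ‖φ.toFun (τS + c) y1 - φ.toFun (τS + c) y2‖ ≤ CS * Real.sqrt C * Real.exp (-(ν * a)) := by
    intro a ha
    obtain ⟨c, hc, hc'⟩ := pb_mean hFc (a := a) one_pos (hC a (a + 1) ha (by linarith))
    have hc0 : 0 ≤ c := le_trans ha hc.1
    refine ⟨c, hc, (sm_decay ι φ (ν := ν) (A := C) hCS y1 y2 hτS hc0 hS ?_).trans ?_⟩
    · rw [← hFe c hc0]; linarith
    · apply mul_le_mul_of_nonneg_left _ (by positivity)
      apply Real.exp_le_exp.2
      nlinarith [hc.1]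
  choose! g hg1 hg2 using good
  intro k hk
  obtain ⟨t, ht1, ht2, ht3⟩ := om_seq φ hk
  set a : ℕ → ℝ := fun n => t n - τS - 1 with ha
  have ha2 : Tendsto a atTop atTop := by
    simp only [ha, sub_eq_add_neg]
    exact tendsto_atTop_add_const_right _ _ (tendsto_atTop_add_const_right _ _ ht2)
  have ha0 := ha2.eventually_ge_atTop 0
  set b : ℕ → ℝ := fun n => τS + g (a n) with hb
  have hb2 : Tendsto b atTop atTop := by
    apply tendsto_atTop_mono' _ _ ha2
    filter_upwards [ha0] with n hn
    have := (hg1 _ hn).1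
    simp only [hb]; linarith
  obtain ⟨q, hq, ψ, hψ, hc⟩ := om_subseq φ hy1 hb2
  -- θ
  set θ : ℕ → ℝ := fun n => max 0 (min 1 (t n - b n)) with hθ
  have hθe : ∀ᶠ n in atTop, θ n = t n - b n := by
    filter_upwards [ha0] with n hn
    have h1 := hg1 _ hn
    simp only [hθ, hb]
    have h2 := h1.1
    have h3 := h1.2
    simp only [ha] at h2 h3 ⊢
    rw [min_eq_right (by linarith), max_eq_right (by linarith)]
  have hθm : ∀ n, θ n ∈ Icc (0:ℝ) 1 := fun n => ⟨le_max_left _ _, by simp [hθ]⟩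
  obtain ⟨θ0, hθ0, ψ', hψ', hc'⟩ := (isCompact_Icc (a := (0:ℝ)) (b := 1)).tendsto_subseq
    (x := fun n => θ (ψ n)) (fun n => hθm _)
  have hd : Tendsto (fun n => φ.toFun (b n) y1 - φ.toFun (b n) y2) atTop (𝓝 0) := by
    apply squeeze_zero_norm' (a := fun n => CS * Real.sqrt C * Real.exp (-(ν * a n)))
    · filter_upwards [ha0] with n hn
      exact hg2 _ hn
    · rw [← mul_zero (CS * Real.sqrt C)]
      apply Tendsto.const_mul
      apply Real.tendsto_exp_atBot.comp
      apply tendsto_neg_atTop_atBot.comp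
      exact ha2.const_mul_atTop hν
  have hψψ := hψ.tendsto_atTop.comp hψ'.tendsto_atTop
  have l1 : Tendsto (fun n => φ.toFun (b (ψ (ψ' n))) y1) atTop (𝓝 q) := hc.comp hψ'.tendsto_atTop
  have l2 : Tendsto (fun n => φ.toFun (b (ψ (ψ' n))) y2) atTop (𝓝 q) := by
    have := l1.sub (hd.comp hψψ)
    simpa using this
  have m1 := sf_tendsto φ hc' l1 (fun n => (hθm _).1) hθ0.1
  have m2 := sf_tendsto φ hc' l2 (fun n => (hθm _).1) hθ0.1
  have hev : ∀ᶠ n in atTop, ∀ y, φ.toFun (θ (ψ (ψ' n))) (φ.toFun (b (ψ (ψ' n))) y)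
      = φ.toFun (t (ψ (ψ' n))) y := by
    filter_upwards [hψψ.eventually hθe, hψψ.eventually (hb2.eventually_ge_atTop 0)] with n h1 h2 y
    simp only [Function.comp] at h1 h2
    rw [← φ.map_add' _ _ (hθm _).1 h2, h1]
    ring_nf
  have m1' := m1.congr' (hev.mono fun n hn => hn y1)
  have m2' := m2.congr' (hev.mono fun n hn => hn y2)
  have hkq := tendsto_nhds_unique m1' (ht3.comp hψψ)
  rw [hkq] at m2'
  exact om_of_seq φ (ht2.comp hψψ) m2'

lemma per_orbit (ι : E →L[ℝ] H) (φ : Semiflow E) (P : E →L[ℝ] E →L[ℝ] ℝ) (δ τV ν : ℝ)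
    (hH3 : φ.IsH3 ι P δ τV ν) (hS : φ.IsSmoothing ι) (y : E) (hy : pbTail φ y) {s : ℝ} (hs : 0 < s)
    (hV : ∀ t ≥ 0, 0 ≤ P (φ.toFun t (φ.toFun s y) - φ.toFun t y)
      (φ.toFun t (φ.toFun s y) - φ.toFun t y)) :
    ∃ q, φ.toFun s q = q ∧ φ.omegaLimit y = φ.orbit q := by
  obtain ⟨F, hFc, hF0, hFe, C, hC⟩ := nonneg_bound ι φ P δ τV ν hH3 _ _ hV
  obtain ⟨τS, CS, hτS, hCS, hS⟩ := hS
  have hν := hH3.2.2.1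
  have hN : ∀ N : ℕ, ∃ t ∈ Icc (0:ℝ) (0 + s), s * ∑ j ∈ Finset.range N, F (t + j * s) ≤ C := by
    intro N
    apply pb_mean (f := fun t => ∑ j ∈ Finset.range N, F (t + j * s)) (by fun_prop) hs
    rw [intervalIntegral.integral_finsetSum (fun j _ =>
      (Continuous.intervalIntegrable (by fun_prop) _ _))]
    have e : ∀ j : ℕ, ∫ t in (0:ℝ)..(0 + s), F (t + j * s) =
        ∫ t in ((j:ℕ) * s)..((j + 1 : ℕ) * s), F t := by
      intro j
      rw [intervalIntegral.integral_comp_add_right]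
      push_cast
      ring_nf
    simp only [e]
    rw [intervalIntegral.sum_integral_adjacent_intervals (a := fun j : ℕ => (j:ℝ) * s)
      (fun j _ => hFc.intervalIntegrable _ _)]
    apply hC
    · simp
    · simp; positivity
  choose tN ht1 ht2 using hN
  obtain ⟨ts, hts, ψ, hψ, hc⟩ := (isCompact_Icc (a := (0:ℝ)) (b := 0 + s)).tendsto_subseq ht1
  have hF : ∀ j : ℕ, F (ts + j * s) ≤ C / s := by
    intro j
    have h1 : Tendsto (fun n => F (tN (ψ n) + j * s)) atTop (𝓝 (F (ts + j * s))) :=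
      (hFc.tendsto _).comp (hc.add_const _)
    apply le_of_tendsto h1
    filter_upwards [hψ.tendsto_atTop.eventually_gt_atTop j] with n hn
    rw [le_div_iff₀ hs]
    have h2 := Finset.single_le_sum (f := fun j : ℕ => F (tN (ψ n) + j * s))
      (fun i _ => hF0 _) (Finset.mem_range.2 hn)
    have h3 := ht2 (ψ n)
    have := mul_le_mul_of_nonneg_left h2 hs.le
    linarith
  set b := τS + ts with hb
  have hb0 : 0 ≤ b := by linarith [hts.1]
  set a : ℕ → E := fun j => φ.toFun (b + j * s) y with ha
  have hbj : ∀ j : ℕ, 0 ≤ b + j * s := fun j => by positivity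
  have hfs : ∀ j, φ.toFun s (a j) = a (j + 1) := by
    intro j
    simp only [ha]
    rw [← φ.map_add' _ _ hs.le (hbj j)]
    push_cast
    ring_nf
  have hcau : CauchySeq a := by
    apply cauchySeq_of_le_geometric (Real.exp (-(ν * s))) (CS * Real.sqrt (C / s))
    · rw [Real.exp_lt_one_iff]; nlinarith
    · intro j
      have hj : 0 ≤ ts + j * s := by have := hts.1; positivity
      have h1 := sm_decay ι φ (ν := ν) (A := C / s) hCS (φ.toFun s y) y hτS hj hS
        (by rw [← hFe _ hj]; exact hF j)
      have e1 : φ.toFun (τS + (ts + j * s)) (φ.toFun s y) = a (j + 1) := by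
        simp only [ha, hb]
        rw [← φ.map_add' _ _ (by linarith) hs.le]
        push_cast
        ring_nf
      have e2 : φ.toFun (τS + (ts + j * s)) y = a j := by
        simp only [ha, hb, add_assoc]
      rw [e1, e2] at h1
      rw [dist_comm, dist_eq_norm]
      refine h1.trans ?_
      apply mul_le_mul_of_nonneg_left _ (by positivity)
      rw [← Real.exp_nat_mul]
      apply Real.exp_le_exp.2
      have := mul_nonneg hν.le hts.1
      nlinarith
  have hbt : Tendsto (fun j : ℕ => b + j * s) atTop atTop :=
    tendsto_atTop_add_const_left _ _ (tendsto_natCast_atTop_atTop.atTop_mul_const hs)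
  obtain ⟨q, hq, ψ1, hψ1, hc1⟩ := om_subseq φ hy hbt
  have haq : Tendsto a atTop (𝓝 q) :=
    tendsto_nhds_of_cauchySeq_of_subseq hcau hψ1.tendsto_atTop hc1
  refine ⟨q, ?_, ?_⟩
  · refine tendsto_nhds_unique (((sf_cont φ hs.le).tendsto q).comp haq) ?_
    refine (haq.comp (tendsto_add_atTop_nat 1)).congr fun j => ?_
    simp only [Function.comp]
    rw [hfs]
  · apply Subset.antisymm
    · intro k hk
      obtain ⟨t, h1, h2, h3⟩ := om_seq φ hk
      have h4 : Tendsto (fun n => t n - b) atTop atTop := tendsto_atTop_add_const_right _ (-b) h2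
      set J : ℕ → ℕ := fun n => ⌊(t n - b) / s⌋₊ with hJ
      have hJt : Tendsto J atTop atTop :=
        tendsto_nat_floor_atTop.comp (h4.atTop_div_const hs)
      set θ : ℕ → ℝ := fun n => max 0 (min s (t n - (b + J n * s))) with hθ
      have hθe : ∀ᶠ n in atTop, θ n = t n - (b + J n * s) := by
        filter_upwards [h4.eventually_ge_atTop 0] with n hn
        have k1 : (J n : ℝ) ≤ (t n - b) / s := Nat.floor_le (by positivity)
        have k2 : (t n - b) / s < J n + 1 := Nat.lt_floor_add_one _
        rw [le_div_iff₀ hs] at k1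
        rw [div_lt_iff₀ hs] at k2
        simp only [hθ]
        rw [min_eq_right (by linarith), max_eq_right (by linarith)]
      have hθm : ∀ n, θ n ∈ Icc (0:ℝ) s := fun n =>
        ⟨le_max_left _ _, max_le hs.le (min_le_left _ _)⟩
      obtain ⟨θ0, hθ0, ψ', hψ', hc'⟩ := (isCompact_Icc (a := (0:ℝ)) (b := s)).tendsto_subseq hθm
      have l1 : Tendsto (fun n => a (J (ψ' n))) atTop (𝓝 q) :=
        haq.comp (hJt.comp hψ'.tendsto_atTop)
      have l2 := sf_tendsto φ hc' l1 (fun n => (hθm _).1) hθ0.1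
      refine ⟨θ0, hθ0.1, tendsto_nhds_unique (l2.congr' ?_) (h3.comp hψ'.tendsto_atTop)⟩
      filter_upwards [hψ'.tendsto_atTop.eventually hθe] with n hn
      simp only [Function.comp, ha]
      rw [← φ.map_add' _ _ (hθm _).1 (hbj _), hn]
      ring_nf
    · rintro _ ⟨θ, hθ, rfl⟩
      exact om_fwd φ hq hθ

lemma per_T12 (φ : Semiflow E) {K : Set E} {q : E} {s : ℝ} (hs : 0 < s) (hq : φ.toFun s q = q)
    (hK : K = φ.orbit q) : (∃ v₀ : E, φ.IsStationary v₀ ∧ K = {v₀}) ∨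
    (∃ v₀ : E, φ.IsPeriodicPt v₀ ∧ K = φ.orbit v₀) := by
  by_cases h : φ.IsStationary q
  · left
    refine ⟨q, h, ?_⟩
    rw [hK]
    ext w
    constructor
    · rintro ⟨t, ht, rfl⟩
      exact h t ht
    · rintro rfl
      exact ⟨0, le_rfl, φ.map_zero' _⟩
  · right
    exact ⟨q, ⟨h, s, hs, hq⟩, hK⟩

end dyn


section projection
variable {E : Type*} [NormedAddCommGroup E] [NormedSpace ℝ E]

lemma pb_proj (P : E →L[ℝ] E →L[ℝ] ℝ) (Eplus Eminus : Submodule ℝ E)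
    (hH1 : Semiflow.IsH1 P Eplus Eminus) [FiniteDimensional ℝ ↥Eminus]
    (hH2 : Module.finrank ℝ ↥Eminus = 2) :
    ∃ Q : E →L[ℝ] ℂ, ∀ d, P d d < 0 → Q d ≠ 0 := by
  obtain ⟨-, hcl, -, hcompl, hpos, -⟩ := hH1
  have : IsClosed (Eplus : Set E) := hcl
  have : FiniteDimensional ℝ (E ⧸ Eplus) :=
    LinearEquiv.finiteDimensional (Submodule.quotientEquivOfIsCompl Eplus Eminus hcompl).symm
  have hfr : Module.finrank ℝ (E ⧸ Eplus) = Module.finrank ℝ ℂ := by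
    rw [(Submodule.quotientEquivOfIsCompl Eplus Eminus hcompl).finrank_eq, hH2,
      Complex.finrank_real_complex]
  let e : (E ⧸ Eplus) ≃ₗ[ℝ] ℂ := LinearEquiv.ofFinrankEq _ _ hfr
  have hc1 : Continuous (e : (E ⧸ Eplus) →ₗ[ℝ] ℂ) :=
    LinearMap.continuous_of_finiteDimensional _
  have hc2 : Continuous (Eplus.mkQ) := Eplus.mkQL.continuous
  refine ⟨⟨(e : (E ⧸ Eplus) →ₗ[ℝ] ℂ).comp Eplus.mkQ, hc1.comp hc2⟩, ?_⟩
  intro d hd h0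
  have h1 : e (Eplus.mkQ d) = 0 := h0
  rw [LinearEquiv.map_eq_zero_iff, Submodule.mkQ_apply, Submodule.Quotient.mk_eq_zero] at h1
  by_cases hd0 : d = 0
  · simp [hd0] at hd
  · exact absurd (hpos d h1 hd0) (not_lt.2 hd.le)

end projection

section flowK
variable {E : Type*} [NormedAddCommGroup E] [NormedSpace ℝ E]

/-- complete trajectories in `K` are determined by one value -/
def pbUnique (φ : Semiflow E) (K : Set E) : Prop :=
  ∀ u v : ℝ → E, φ.IsCompleteTrajectory u → φ.IsCompleteTrajectory v → (∀ s, u s ∈ K) →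
    (∀ s, v s ∈ K) → ∀ r, u r = v r → u = v

lemma ct_shift {φ : Semiflow E} {v : ℝ → E} (hv : φ.IsCompleteTrajectory v) (a : ℝ) :
    φ.IsCompleteTrajectory (fun s => v (s + a)) :=
  ⟨hv.1.comp (by fun_prop), fun t ht s => by
    show v (t + s + a) = _
    rw [add_assoc, hv.2 t ht]⟩

/-- complete trajectories in `K` meeting at times `a`, `b` are shifts of each other -/
lemma ct_meet {φ : Semiflow E} {K : Set E} (hU : pbUnique φ K) {u v : ℝ → E}
    (hu : φ.IsCompleteTrajectory u) (hv : φ.IsCompleteTrajectory v) (huK : ∀ s, u s ∈ K)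
    (hvK : ∀ s, v s ∈ K) {a b : ℝ} (h : u a = v b) (s : ℝ) : u (s + a) = v (s + b) := by
  have := hU _ _ (ct_shift hu a) (ct_shift hv b) (fun s => huK _) (fun s => hvK _) 0
    (by simpa using h)
  exact congrFun this s

lemma om_ct (φ : Semiflow E) {y : E} (hy : pbTail φ y) {k : E} (hk : k ∈ φ.omegaLimit y) :
    ∃ v : ℝ → E, φ.IsCompleteTrajectory v ∧ (∀ s, v s ∈ φ.omegaLimit y) ∧ v 0 = k :=
  ct_exists φ (fun _ hk _ hs => om_fwd φ hk hs) (fun _ hk _ hs => om_bwd φ hy hk hs) hk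

lemma seq_lemma (φ : Semiflow E) {y : E} (hy : pbTail φ y) {M : ℝ} {t σ : ℕ → ℝ}
    (ht : Tendsto t atTop atTop) (hσ : ∀ n, |σ n| ≤ M) :
    ∃ v : ℝ → E, φ.IsCompleteTrajectory v ∧ (∀ s, v s ∈ φ.omegaLimit y) ∧
      ∃ ψ : ℕ → ℕ, StrictMono ψ ∧ ∃ σ0, |σ0| ≤ M ∧ Tendsto (fun n => σ (ψ n)) atTop (𝓝 σ0) ∧
      Tendsto (fun n => φ.toFun (t (ψ n)) y) atTop (𝓝 (v 0)) ∧
      Tendsto (fun n => φ.toFun (t (ψ n) + σ (ψ n)) y) atTop (𝓝 (v σ0)) := by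
  have hM : 0 ≤ M := (abs_nonneg _).trans (hσ 0)
  have ht' : Tendsto (fun n => t n - M) atTop atTop := tendsto_atTop_add_const_right _ _ ht
  obtain ⟨k, hk, ψ1, hψ1, hk'⟩ := om_subseq φ hy ht'
  obtain ⟨σ0, hσ0, ψ2, hψ2, hσ'⟩ := (isCompact_Icc (a := -M) (b := M)).tendsto_subseq
    (x := fun n => σ (ψ1 n)) (fun n => abs_le.1 (hσ _))
  obtain ⟨v, hv, hvK, hv0⟩ := om_ct φ hy hk
  have hbig : ∀ᶠ n in atTop, M ≤ t (ψ1 (ψ2 n)) :=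
    (ht.comp (hψ1.comp hψ2).tendsto_atTop).eventually_ge_atTop M
  have hlim := hk'.comp hψ2.tendsto_atTop
  refine ⟨fun s => v (s + M), ct_shift hv M, fun s => hvK _, fun n => ψ1 (ψ2 n), hψ1.comp hψ2,
    σ0, abs_le.2 hσ0, hσ', ?_, ?_⟩
  · have h1 := sf_tendsto φ (t := fun _ => M) tendsto_const_nhds hlim (fun _ => hM) hM
    have h2 : v (0 + M) = φ.toFun M k := by rw [add_comm, hv.2 M hM, hv0]
    show Tendsto _ _ (𝓝 (v (0 + M)))
    rw [h2]
    refine h1.congr' ?_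
    filter_upwards [hbig] with n hn
    simp only [Function.comp]
    rw [← φ.map_add' _ _ hM (by linarith)]
    ring_nf
  · have hn0 : ∀ n, 0 ≤ σ (ψ1 (ψ2 n)) + M := fun n => by
      have := (abs_le.1 (hσ (ψ1 (ψ2 n)))).1; linarith
    have h00 : 0 ≤ σ0 + M := by have := hσ0.1; linarith
    have h1 := sf_tendsto φ (t := fun n => σ (ψ1 (ψ2 n)) + M) (hσ'.add_const M) hlim hn0 h00
    have h2 : v (σ0 + M) = φ.toFun (σ0 + M) k := by
      rw [← add_zero (σ0 + M), hv.2 _ h00, hv0, add_zero]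
    show Tendsto _ _ (𝓝 (v (σ0 + M)))
    rw [h2]
    refine h1.congr' ?_
    filter_upwards [hbig] with n hn
    simp only [Function.comp]
    rw [← φ.map_add' _ _ (hn0 n) (by linarith)]
    ring_nf

lemma per_mul {z : ℝ → E} {r : ℝ} (h : ∀ t, z (t + r) = z t) (n : ℤ) (t : ℝ) :
    z (t + n * r) = z t := by
  have : Function.Periodic z r := h
  simpa using this.int_mul n t

/-- no small periods -/
lemma small_per {z : ℝ → E} (hz : Continuous z)
    (h : ∀ M > 0, ∃ r, 0 < r ∧ r ≤ M ∧ ∀ t, z (t + r) = z t) (t : ℝ) : z t = z 0 := by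
  by_contra hne
  have hpos : 0 < dist (z t) (z 0) := dist_pos.2 hne
  obtain ⟨d, hd, hd'⟩ := Metric.continuousAt_iff.1 (hz.continuousAt (x := (0:ℝ))) _ hpos
  obtain ⟨r, hr, hrd, hper⟩ := h (d / 2) (by positivity)
  have h1 := per_mul hper (-⌊t / r⌋) t
  have h2 : dist (t + ((-⌊t / r⌋ : ℤ) : ℝ) * r) 0 < d := by
    have e1 := Int.floor_le (t / r)
    have e2 := Int.lt_floor_add_one (t / r)
    rw [le_div_iff₀ hr] at e1
    rw [div_lt_iff₀ hr] at e2
    rw [Real.dist_eq, sub_zero, abs_lt]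
    push_cast
    constructor <;> nlinarith
  have := hd' h2
  rw [h1] at this
  exact lt_irrefl _ this

lemma pb_star (φ : Semiflow E) {y : E} (hy : pbTail φ y) (Q : E →L[ℝ] ℂ)
    (hQ : ∀ a ∈ φ.omegaLimit y, ∀ b ∈ φ.omegaLimit y, Q a = Q b → a = b)
    (hU : pbUnique φ (φ.omegaLimit y))
    (hD2 : ∀ ε0 > 0, ∃ T ≥ 0, ∀ t ≥ T, ∀ s ≥ ε0, Q (φ.toFun t y) ≠ Q (φ.toFun (t + s) y))
    {z : ℝ → E} (hz : φ.IsCompleteTrajectory z) (hzK : ∀ s, z s ∈ φ.omegaLimit y)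
    (hns : ¬ φ.IsStationary (z 0)) :
    ∃ s1 ρ M : ℝ, 0 < ρ ∧ ∀ k ∈ φ.omegaLimit y, ‖Q k - Q (z s1)‖ < ρ →
      ∃ τ, |τ| ≤ M ∧ k = z (s1 + τ) := by
  obtain ⟨M, hM, hinj⟩ : ∃ M > 0, ∀ s s', 0 < |s - s'| → |s - s'| ≤ M → Q (z s) ≠ Q (z s') := by
    by_contra hcon
    push Not at hcon
    apply hns
    have hper : ∀ M > 0, ∃ r, 0 < r ∧ r ≤ M ∧ ∀ t, z (t + r) = z t := by
      intro M hM
      obtain ⟨s, s', h1, h2, h3⟩ := hcon M hM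
      have h4 := hQ _ (hzK s) _ (hzK s') h3
      refine ⟨|s - s'|, h1, h2, fun t => ?_⟩
      rcases le_total s s' with hle | hle
      · have := ct_meet hU hz hz hzK hzK h4 (t - s)
        rw [abs_of_nonpos (by linarith)]
        rw [sub_add_cancel] at this
        rw [this]; congr 1; ring
      · have := ct_meet hU hz hz hzK hzK h4 (t - s')
        rw [abs_of_nonneg (by linarith)]
        rw [sub_add_cancel] at this
        rw [← this]; congr 1; ring
    intro t ht
    rw [← hz.2 t ht, add_zero]
    exact small_per hz.1 hper t
  have hp : Continuous fun t => Q (φ.toFun (max t 0) y) := Q.continuous.comp (sf_path φ y)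
  have hζ : Continuous fun s => Q (z s) := Q.continuous.comp hz.1
  have D1 : ∀ s0, ∀ η > 0, ∃ ρ > 0, ∃ T, ∀ t ≥ T, ‖Q (φ.toFun (max t 0) y) - Q (z s0)‖ < ρ →
      ∀ s, |s| ≤ M → ‖Q (φ.toFun (max (t + s) 0) y) - Q (z (s0 + s))‖ < η := by
    intro s0 η hη
    by_contra hcon
    push Not at hcon
    have hc : ∀ n : ℕ, ∃ t, (n:ℝ) + M ≤ t ∧
        ‖Q (φ.toFun (max t 0) y) - Q (z s0)‖ < 1 / ((n:ℝ) + 1) ∧ ∃ s, |s| ≤ M ∧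
        η ≤ ‖Q (φ.toFun (max (t + s) 0) y) - Q (z (s0 + s))‖ := fun n =>
      hcon (1 / ((n:ℝ) + 1)) (by positivity) (n + M)
    choose t ht1 ht2 σ hσ1 hσ2 using hc
    have htT : Tendsto t atTop atTop := tendsto_atTop_mono (fun n => by
      have := ht1 n; linarith) tendsto_natCast_atTop_atTop
    obtain ⟨v, hv, hvK, ψ, hψ, σ0, hσ0, l1, l2, l3⟩ := seq_lemma φ hy htT hσ1
    have m1 : ∀ n, max (t n) 0 = t n := fun n => max_eq_left (by
      have := ht1 n; have : (0:ℝ) ≤ n := Nat.cast_nonneg n; linarith)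
    have m2 : ∀ n, max (t n + σ n) 0 = t n + σ n := fun n => max_eq_left (by
      have := ht1 n; have : (0:ℝ) ≤ n := Nat.cast_nonneg n
      have := (abs_le.1 (hσ1 n)).1; linarith)
    have c1 : Tendsto (fun n => Q (φ.toFun (t (ψ n)) y)) atTop (𝓝 (Q (v 0))) :=
      (Q.continuous.tendsto _).comp l2
    have c2 : Tendsto (fun n => Q (φ.toFun (t (ψ n)) y)) atTop (𝓝 (Q (z s0))) := by
      rw [tendsto_iff_norm_sub_tendsto_zero]
      refine squeeze_zero (fun n => norm_nonneg _) (fun n => ?_)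
        (tendsto_one_div_add_atTop_nhds_zero_nat.comp hψ.tendsto_atTop)
      have := ht2 (ψ n)
      rw [m1] at this
      exact this.le
    have c3 := hQ _ (hvK _) _ (hzK _) (tendsto_nhds_unique c1 c2)
    have c4 := ct_meet hU hv hz hvK hzK c3 σ0
    rw [add_zero] at c4
    rw [c4] at l3
    have c5 : Tendsto (fun n => Q (z (s0 + σ (ψ n)))) atTop (𝓝 (Q (z (s0 + σ0)))) :=
      (hζ.tendsto _).comp (l1.const_add s0)
    have c6 := ((Q.continuous.tendsto _).comp l3).sub c5
    rw [add_comm σ0, sub_self] at c6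
    have c7 := c6.norm
    rw [norm_zero] at c7
    obtain ⟨n, hn⟩ := (c7.eventually (gt_mem_nhds hη)).exists
    have := hσ2 (ψ n)
    rw [m2] at this
    exact absurd hn (not_lt.2 this)
  have D2 : ∀ ε0 > 0, ∃ T, ∀ t ≥ T, ∀ s ≥ ε0,
      Q (φ.toFun (max t 0) y) ≠ Q (φ.toFun (max (t + s) 0) y) := by
    intro ε0 hε0
    obtain ⟨T, hT, h⟩ := hD2 ε0 hε0
    refine ⟨T, fun t ht s hs => ?_⟩
    rw [max_eq_left (by linarith), max_eq_left (by linarith)]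
    exact h t ht s hs
  have near : ∀ k ∈ φ.omegaLimit y, ∀ ρ > 0, ∀ T, ∃ t ≥ T, 0 ≤ t ∧
      ‖Q (φ.toFun t y) - Q k‖ < ρ := by
    intro k hk ρ hρ T
    obtain ⟨t, -, h2, h3⟩ := om_seq φ hk
    have h4 := (tendsto_iff_norm_sub_tendsto_zero.1 ((Q.continuous.tendsto _).comp h3))
    obtain ⟨n, ⟨a1, a2⟩, a3⟩ := (((h2.eventually_ge_atTop T).and (h2.eventually_ge_atTop 0)).and
      (h4.eventually (gt_mem_nhds hρ))).exists
    exact ⟨t n, a1, a2, a3⟩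
  have D3 : ∀ s0, ∀ ρ > 0, ∀ T, ∃ t ≥ T, ‖Q (φ.toFun (max t 0) y) - Q (z s0)‖ < ρ := by
    intro s0 ρ hρ T
    obtain ⟨t, h1, h2, h3⟩ := near _ (hzK s0) ρ hρ T
    exact ⟨t, h1, by rwa [max_eq_left h2]⟩
  obtain ⟨s1, ρ, hρ, hfin⟩ := pb_planar _ _ hp hζ M hM hinj D1 D2 D3
  refine ⟨s1, ρ, M, hρ, fun k hk hkρ => ?_⟩
  have hc : ∀ n : ℕ, ∃ t, (n:ℝ) + M ≤ t ∧ ‖Q (φ.toFun t y) - Q k‖ < 1 / ((n:ℝ) + 1) ∧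
      ∃ l, |l - t| ≤ M ∧ ‖Q (φ.toFun (max l 0) y) - Q (z s1)‖ < 1 / ((n:ℝ) + 1) := by
    intro n
    obtain ⟨T, hT⟩ := hfin (1 / ((n:ℝ) + 1)) (by positivity)
    obtain ⟨t, h1, h2, h3⟩ := near k hk
      (min (1 / ((n:ℝ) + 1)) (ρ - ‖Q k - Q (z s1)‖)) (lt_min (by positivity) (by linarith))
      (max T (n + M))
    refine ⟨t, (le_max_right _ _).trans h1, h3.trans_le (min_le_left _ _), ?_⟩
    apply hT t ((le_max_left _ _).trans h1)
    simp only [max_eq_left h2]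
    have h4 := h3.trans_le (min_le_right _ _)
    have h5 := norm_sub_le_norm_sub_add_norm_sub (Q (φ.toFun t y)) (Q k) (Q (z s1))
    linarith
  choose t ht1 ht2 l hl1 hl2 using hc
  have htT : Tendsto t atTop atTop := tendsto_atTop_mono (fun n => by
    have := ht1 n; linarith) tendsto_natCast_atTop_atTop
  obtain ⟨v, hv, hvK, ψ, hψ, σ0, hσ0, l1, l2, l3⟩ := seq_lemma φ hy htT hl1
  have m2 : ∀ n, max (l n) 0 = l n := fun n => max_eq_left (by
    have := ht1 n; have : (0:ℝ) ≤ n := Nat.cast_nonneg n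
    have := (abs_le.1 (hl1 n)).1; linarith)
  have hlim0 := tendsto_one_div_add_atTop_nhds_zero_nat (𝕜 := ℝ).comp hψ.tendsto_atTop
  have c1 : Tendsto (fun n => Q (φ.toFun (t (ψ n)) y)) atTop (𝓝 (Q (v 0))) :=
    (Q.continuous.tendsto _).comp l2
  have c2 : Tendsto (fun n => Q (φ.toFun (t (ψ n)) y)) atTop (𝓝 (Q k)) := by
    rw [tendsto_iff_norm_sub_tendsto_zero]
    exact squeeze_zero (fun n => norm_nonneg _) (fun n => (ht2 (ψ n)).le) hlim0
  have c3 : v 0 = k := hQ _ (hvK _) _ hk (tendsto_nhds_unique c1 c2)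
  have d1 : Tendsto (fun n => Q (φ.toFun (l (ψ n)) y)) atTop (𝓝 (Q (v σ0))) := by
    have := (Q.continuous.tendsto _).comp l3
    simpa [Function.comp_def] using this
  have d2 : Tendsto (fun n => Q (φ.toFun (l (ψ n)) y)) atTop (𝓝 (Q (z s1))) := by
    rw [tendsto_iff_norm_sub_tendsto_zero]
    refine squeeze_zero (fun n => norm_nonneg _) (fun n => ?_) hlim0
    have := hl2 (ψ n)
    rw [m2] at this
    exact this.le
  have d3 := hQ _ (hvK _) _ (hzK _) (tendsto_nhds_unique d1 d2)
  have d4 := ct_meet hU hv hz hvK hzK d3 (-σ0)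
  refine ⟨-σ0, by rwa [abs_neg], ?_⟩
  rw [← c3, add_comm s1, ← d4]
  simp

end flowK


section mainK
variable {E : Type*} [NormedAddCommGroup E] [NormedSpace ℝ E]

lemma al_seq (φ : Semiflow E) {v : ℝ → E} {k : E} (hk : k ∈ φ.alphaLimitOf v) {ε R : ℝ}
    (hε : 0 < ε) : ∃ t ≤ R, dist (v t) k < ε := by
  unfold Semiflow.alphaLimitOf at hk
  simp only [mem_iInter, Metric.mem_closure_iff] at hk
  obtain ⟨b, ⟨t, ht, rfl⟩, hb⟩ := hk (min R 0) (mem_Iic.2 (min_le_right _ _)) ε hε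
  exact ⟨t, ht.trans (min_le_left _ _), by rwa [dist_comm]⟩

lemma pb_recur (φ : Semiflow E) {y : E} (hy : pbTail φ y) (Q : E →L[ℝ] ℂ)
    (hU : pbUnique φ (φ.omegaLimit y))
    {z v : ℝ → E} (hz : φ.IsCompleteTrajectory z) (hzK : ∀ s, z s ∈ φ.omegaLimit y)
    (hv : φ.IsCompleteTrajectory v) (hvK : ∀ s, v s ∈ φ.omegaLimit y)
    (hlim : z 0 ∈ φ.omegaLimit (v 0) ∨ z 0 ∈ φ.alphaLimitOf v) {s1 ρ M : ℝ} (hρ : 0 < ρ)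
    (hstar : ∀ k ∈ φ.omegaLimit y, ‖Q k - Q (z s1)‖ < ρ → ∃ τ, |τ| ≤ M ∧ k = z (s1 + τ)) :
    ∃ σ > 0, ∀ t, z (t + σ) = z t := by
  have hfar : ∀ n : ℕ, ∃ t, (n:ℝ) ≤ |t| ∧ dist (v t) (z 0) < 1 / ((n:ℝ) + 1) := by
    intro n
    have hp : 0 < 1 / ((n:ℝ) + 1) := by positivity
    rcases hlim with h | h
    · obtain ⟨t, ht, ht'⟩ := (om_mem_iff φ _ _).1 h _ hp n (Nat.cast_nonneg n)
      have h0 : (0:ℝ) ≤ n := Nat.cast_nonneg n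
      rw [← hv.2 t (by linarith), add_zero] at ht'
      exact ⟨t, ht.trans (le_abs_self t), ht'⟩
    · obtain ⟨t, ht, ht'⟩ := al_seq φ h hp (R := -n)
      exact ⟨t, by have := neg_le_abs t; linarith, ht'⟩
  choose t ht1 ht2 using hfar
  have hconv : Tendsto (fun n => v (t n)) atTop (𝓝 (z 0)) := by
    rw [tendsto_iff_dist_tendsto_zero]
    exact squeeze_zero (fun n => dist_nonneg) (fun n => (ht2 n).le)
      tendsto_one_div_add_atTop_nhds_zero_nat
  have habs : Tendsto (fun n => |t n|) atTop atTop :=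
    tendsto_atTop_mono ht1 tendsto_natCast_atTop_atTop
  obtain ⟨ψ, hψ, hc⟩ : ∃ ψ : ℕ → ℕ, StrictMono ψ ∧
      Tendsto (fun n => v (t (ψ n) + s1)) atTop (𝓝 (z s1)) := by
    rcases le_total 0 s1 with h | h
    · refine ⟨id, strictMono_id, ?_⟩
      have h1 := (sf_cont φ h).continuousAt.tendsto.comp hconv
      rw [← hz.2 s1 h, add_zero] at h1
      refine h1.congr fun n => ?_
      simp only [Function.comp, id]
      rw [← hv.2 s1 h, add_comm]
    · obtain ⟨k, hk, ψ, hψ, hlim⟩ := (om_compact φ hy).tendsto_subseq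
        (x := fun n => v (t n + s1)) (fun n => hvK _)
      refine ⟨ψ, hψ, ?_⟩
      have hs : 0 ≤ -s1 := by linarith
      have h1 := (sf_cont φ hs).continuousAt.tendsto.comp hlim
      have h2 : Tendsto (fun n => v (t (ψ n))) atTop (𝓝 (φ.toFun (-s1) k)) := by
        refine h1.congr fun n => ?_
        simp only [Function.comp]
        rw [← hv.2 _ hs]
        congr 1; ring
      have h3 := tendsto_nhds_unique h2 (hconv.comp hψ.tendsto_atTop)
      obtain ⟨u, hu, huK, hu0⟩ := om_ct φ hy hk
      have h4 : u (-s1) = z 0 := by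
        rw [← h3, ← hu0, ← hu.2 _ hs, add_zero]
      have h5 := ct_meet hU hu hz huK hzK h4 s1
      rw [add_neg_cancel, add_zero, hu0] at h5
      rw [← h5]
      exact hlim
  have hev : ∀ᶠ n in atTop, ∃ τ, |τ| ≤ M ∧ v (t (ψ n) + s1) = z (s1 + τ) := by
    have h4 := (tendsto_iff_norm_sub_tendsto_zero.1 ((Q.continuous.tendsto _).comp hc))
    filter_upwards [h4.eventually (gt_mem_nhds hρ)] with n hn
    exact hstar _ (hvK _) hn
  obtain ⟨n, τ, hτ, hn⟩ := hev.exists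
  obtain ⟨m, ⟨τ', hτ', hm⟩, hfar⟩ := (hev.and
    ((habs.comp hψ.tendsto_atTop).eventually_gt_atTop (|t (ψ n)| + 2 * M))).exists
  simp only [Function.comp] at hfar
  set a := t (ψ n)
  set b := t (ψ m)
  have p1 : ∀ x, v x = z (x - a + τ) := fun x => by
    have := ct_meet hU hv hz hvK hzK hn (x - (a + s1))
    rw [sub_add_cancel] at this
    rw [this]; congr 1; ring
  have p2 : ∀ x, v x = z (x - b + τ') := fun x => by
    have := ct_meet hU hv hz hvK hzK hm (x - (b + s1))
    rw [sub_add_cancel] at this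
    rw [this]; congr 1; ring
  have p3 : ∀ x, z (x + (b - a + τ - τ')) = z x := fun x => by
    have e1 := p1 (x + b - τ')
    rw [p2] at e1
    ring_nf at e1 ⊢
    rw [e1]
  have hne : b - a + τ - τ' ≠ 0 := by
    intro h0
    have e1 : b = a + (τ' - τ) := by linarith
    have e2 := abs_add_le a (τ' - τ)
    have e3 := abs_sub τ' τ
    rw [← e1] at e2
    linarith
  rcases lt_or_gt_of_ne hne with h | h
  · refine ⟨-(b - a + τ - τ'), by linarith, fun x => ?_⟩
    rw [← p3 (x + -(b - a + τ - τ')), neg_add_cancel_right]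
  · exact ⟨_, h, p3⟩

lemma pb_closed_orbit (φ : Semiflow E) {y : E} (hy : pbTail φ y) (Q : E →L[ℝ] ℂ)
    (hU : pbUnique φ (φ.omegaLimit y))
    {z : ℝ → E} (hz : φ.IsCompleteTrajectory z) (hzK : ∀ s, z s ∈ φ.omegaLimit y)
    {s1 ρ M : ℝ} (hρ : 0 < ρ)
    (hstar : ∀ k ∈ φ.omegaLimit y, ‖Q k - Q (z s1)‖ < ρ → ∃ τ, |τ| ≤ M ∧ k = z (s1 + τ))
    {σ : ℝ} (hσ : 0 < σ) (hper : ∀ t, z (t + σ) = z t) : φ.omegaLimit y = range z := by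
  have hcomp : IsCompact (range z) :=
    Function.Periodic.compact_of_continuous hper hσ.ne' hz.1
  have hopen : ∀ k ∈ range z, ∃ U, IsOpen U ∧ k ∈ U ∧ U ∩ φ.omegaLimit y ⊆ range z := by
    rintro _ ⟨s, rfl⟩
    obtain ⟨m, hm⟩ := exists_nat_ge ((s - s1) / σ)
    rw [div_le_iff₀ hσ] at hm
    have hu : 0 ≤ s1 - s + m * σ := by linarith
    refine ⟨{x | ‖Q (φ.toFun (s1 - s + m * σ) x) - Q (z s1)‖ < ρ}, ?_, ?_, ?_⟩
    · exact isOpen_lt (((Q.continuous.comp (sf_cont φ hu)).sub continuous_const).norm)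
        continuous_const
    · simp only [mem_ofPred_eq]
      rw [← hz.2 _ hu, show s1 - s + m * σ + s = s1 + ((m:ℤ):ℝ) * σ by push_cast; ring,
        per_mul hper, sub_self, norm_zero]
      exact hρ
    · rintro x ⟨hx1, hx2⟩
      obtain ⟨τ, -, hτ⟩ := hstar _ (om_fwd φ hx2 hu) hx1
      obtain ⟨w, hw, hwK, hw0⟩ := om_ct φ hy hx2
      have h4 : w (s1 - s + m * σ) = z (s1 + τ) := by
        rw [← hτ, ← hw0, ← hw.2 _ hu, add_zero]
      have h5 := ct_meet hU hw hz hwK hzK h4 (-(s1 - s + m * σ))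
      rw [neg_add_cancel, hw0] at h5
      exact ⟨_, h5.symm⟩
  choose! W hW1 hW2 hW3 using hopen
  set O := ⋃ k ∈ range z, W k with hO
  have hOo : IsOpen O := isOpen_biUnion hW1
  have hsub : range z ⊆ φ.omegaLimit y := by rintro _ ⟨s, rfl⟩; exact hzK s
  have hOK : ∀ x ∈ O, x ∈ φ.omegaLimit y → x ∈ range z := by
    intro x hx hxK
    simp only [hO, mem_iUnion] at hx
    obtain ⟨k, hk, hx⟩ := hx
    exact hW3 k hk ⟨hx, hxK⟩
  have hKc : IsCompact (φ.omegaLimit y ∩ Oᶜ) := (om_compact φ hy).inter_right hOo.isClosed_compl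
  have hdis : Disjoint (range z) (φ.omegaLimit y ∩ Oᶜ) := by
    rw [Set.disjoint_left]
    intro x hx hx'
    exact hx'.2 (mem_biUnion hx (hW2 x hx))
  by_contra hne
  obtain ⟨k, hk, hk'⟩ : ∃ k ∈ φ.omegaLimit y, k ∉ range z := by
    by_contra hcon
    push Not at hcon
    exact hne (subset_antisymm hcon hsub)
  obtain ⟨U1, U2, o1, o2, c1, c2, hd⟩ := SeparatedNhds.of_isCompact_isCompact hcomp hKc hdis
  have hcover : φ.omegaLimit y ⊆ U1 ∪ U2 := by
    intro x hx
    by_cases hxO : x ∈ O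
    · exact Or.inl (c1 (hOK x hxO hx))
    · exact Or.inr (c2 ⟨hx, hxO⟩)
  obtain ⟨T, hT, hTU⟩ := om_nbhd φ hy (o1.union o2) hcover
  have hpc : IsPreconnected ((fun t => φ.toFun (max t 0) y) '' Ici T) :=
    isPreconnected_Ici.image _ (sf_path φ y).continuousOn
  have hk2 : k ∈ U2 := c2 ⟨hk, fun h => hk' (hOK k h hk)⟩
  have visit : ∀ U, IsOpen U → ∀ x ∈ φ.omegaLimit y, x ∈ U →
      (((fun t => φ.toFun (max t 0) y) '' Ici T) ∩ U).Nonempty := by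
    intro U hUo x hx hxU
    obtain ⟨ε, hε, hball⟩ := Metric.isOpen_iff.1 hUo x hxU
    obtain ⟨t, ht, htd⟩ := (om_mem_iff φ _ _).1 hx ε hε T hT
    refine ⟨φ.toFun t y, ⟨t, ht, ?_⟩, hball htd⟩
    simp only
    rw [max_eq_left (hT.trans ht)]
  obtain ⟨x, -, hx1, hx2⟩ := hpc U1 U2 o1 o2 (by
    rintro _ ⟨t, ht, rfl⟩
    simp only
    have ht' : T ≤ t := ht
    rw [max_eq_left (hT.trans ht')]
    exact hTU t ht') (visit U1 o1 (z 0) (hzK 0) (c1 ⟨0, rfl⟩)) (visit U2 o2 k hk hk2)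
  exact Set.disjoint_left.1 hd hx1 hx2

lemma pb_main (φ : Semiflow E) {y : E} (hy : pbTail φ y) (Q : E →L[ℝ] ℂ)
    (hQ : ∀ a ∈ φ.omegaLimit y, ∀ b ∈ φ.omegaLimit y, Q a = Q b → a = b)
    (hU : pbUnique φ (φ.omegaLimit y))
    (hD2 : ∀ ε0 > 0, ∃ T ≥ 0, ∀ t ≥ T, ∀ s ≥ ε0, Q (φ.toFun t y) ≠ Q (φ.toFun (t + s) y)) :
    (∃ v₀ : E, φ.IsStationary v₀ ∧ φ.omegaLimit y = {v₀}) ∨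
    (∃ v₀ : E, φ.IsPeriodicPt v₀ ∧ φ.omegaLimit y = φ.orbit v₀) ∨
    (∃ N : Set E, N.Nonempty ∧ (∀ p ∈ N, φ.IsStationary p) ∧
      ∃ T : Set (ℝ → E),
        (∀ v ∈ T, φ.IsCompleteTrajectory v ∧ φ.alphaLimitOf v ⊆ N ∧
          φ.omegaLimit (v 0) ⊆ N) ∧
        φ.omegaLimit y = N ∪ ⋃ v ∈ T, Set.range v) := by
  have hcl : IsClosed (φ.omegaLimit y) := (om_compact φ hy).isClosed
  have homK : ∀ v, φ.IsCompleteTrajectory v → (∀ s, v s ∈ φ.omegaLimit y) →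
      φ.omegaLimit (v 0) ⊆ φ.omegaLimit y := by
    intro v hv hvK k hk
    obtain ⟨t, h1, -, h3⟩ := om_seq φ hk
    exact hcl.mem_of_tendsto h3 (Eventually.of_forall fun n =>
      om_fwd φ (hvK 0) ((Nat.cast_nonneg n).trans (h1 n)))
  have halK : ∀ v, φ.IsCompleteTrajectory v → (∀ s, v s ∈ φ.omegaLimit y) →
      φ.alphaLimitOf v ⊆ φ.omegaLimit y := by
    intro v hv hvK k hk
    rw [← hcl.closure_eq, Metric.mem_closure_iff]
    intro ε hε
    obtain ⟨t, -, ht⟩ := al_seq φ hk hε (R := 0)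
    exact ⟨v t, hvK t, by rwa [dist_comm]⟩
  by_cases hall : ∀ v, φ.IsCompleteTrajectory v → (∀ s, v s ∈ φ.omegaLimit y) →
      ∀ k, (k ∈ φ.omegaLimit (v 0) ∨ k ∈ φ.alphaLimitOf v) → φ.IsStationary k
  · right; right
    obtain ⟨k0, hk0⟩ := om_nonempty φ hy
    obtain ⟨v0, hv0, hv0K, -⟩ := om_ct φ hy hk0
    refine ⟨{k | k ∈ φ.omegaLimit y ∧ φ.IsStationary k}, ?_, fun p hp => hp.2,
      {v | φ.IsCompleteTrajectory v ∧ ∀ s, v s ∈ φ.omegaLimit y}, ?_, ?_⟩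
    · have htail : pbTail φ (v0 0) := ⟨_, om_compact φ hy, 0, le_rfl, fun t ht =>
        om_fwd φ (hv0K 0) ht⟩
      obtain ⟨k, hk⟩ := om_nonempty φ htail
      exact ⟨k, homK v0 hv0 hv0K hk, hall v0 hv0 hv0K k (Or.inl hk)⟩
    · rintro v ⟨hv, hvK⟩
      exact ⟨hv, fun k hk => ⟨halK v hv hvK hk, hall v hv hvK k (Or.inr hk)⟩,
        fun k hk => ⟨homK v hv hvK hk, hall v hv hvK k (Or.inl hk)⟩⟩
    · apply subset_antisymm
      · intro k hk
        obtain ⟨v, hv, hvK, h0⟩ := om_ct φ hy hk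
        exact Or.inr (mem_biUnion (show v ∈ {v | φ.IsCompleteTrajectory v ∧
          ∀ s, v s ∈ φ.omegaLimit y} from ⟨hv, hvK⟩) ⟨0, h0⟩)
      · rintro k (hk | hk)
        · exact hk.1
        · simp only [mem_iUnion] at hk
          obtain ⟨v, ⟨hv, hvK⟩, s, rfl⟩ := hk
          exact hvK s
  · push Not at hall
    obtain ⟨v, hv, hvK, k, hk, hns⟩ := hall
    have hkK : k ∈ φ.omegaLimit y := hk.elim (fun h => homK v hv hvK h) fun h => halK v hv hvK h
    obtain ⟨z, hz, hzK, hz0⟩ := om_ct φ hy hkK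
    rw [← hz0] at hns hk
    obtain ⟨s1, ρ, M, hρ, hstar⟩ := pb_star φ hy Q hQ hU hD2 hz hzK hns
    obtain ⟨σ, hσ, hper⟩ := pb_recur φ hy Q hU hz hzK hv hvK hk hρ hstar
    have hKz := pb_closed_orbit φ hy Q hU hz hzK hρ hstar hσ hper
    have hq : φ.toFun σ (z 0) = z 0 := by rw [← hz.2 σ hσ.le, add_comm, hper]
    have horb : φ.omegaLimit y = φ.orbit (z 0) := by
      rw [hKz]
      apply subset_antisymm
      · rintro _ ⟨s, rfl⟩
        obtain ⟨m, hm⟩ := exists_nat_ge ((-s) / σ)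
        rw [div_le_iff₀ hσ] at hm
        refine ⟨s + m * σ, by linarith, ?_⟩
        rw [← hz.2 _ (by linarith), add_zero]
        exact per_mul hper m s
      · rintro _ ⟨t, ht, rfl⟩
        exact ⟨t + 0, hz.2 t ht 0⟩
    rcases per_T12 φ hσ hq horb with h | h
    · exact Or.inl h
    · exact Or.inr (Or.inl h)

end mainK


section final
variable {E : Type*} [NormedAddCommGroup E] [NormedSpace ℝ E]
variable {H : Type*} [NormedAddCommGroup H] [InnerProductSpace ℝ H]

lemma pb_unique_of (ι : E →L[ℝ] H) (hι : Function.Injective ι) (φ : Semiflow E)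
    (P : E →L[ℝ] E →L[ℝ] ℝ) (δ τV ν : ℝ)
    (hH3 : φ.IsH3 ι P δ τV ν) {K : Set E} (hK : IsCompact K) : pbUnique φ K := by
  intro u v hu hv huK hvK r h
  funext s
  rcases le_total s r with hs | hs
  · by_contra hne
    have := ct_neg ι hι φ P δ τV ν hH3 hK hu hv huK hvK hs hne
    simp [h] at this
  · have h1 := hu.2 (s - r) (by linarith) r
    have h2 := hv.2 (s - r) (by linarith) r
    rw [sub_add_cancel] at h1 h2
    rw [h1, h2, h]

/-- compactness: eventual negativity uniformly over a compact parameter set -/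
lemma pb_unif (ι : E →L[ℝ] H) (φ : Semiflow E) (P : E →L[ℝ] E →L[ℝ] ℝ) (δ τV ν : ℝ)
    (hH3 : φ.IsH3 ι P δ τV ν) (y : E) {C : Set E} (hC : IsCompact C)
    (h : ∀ k ∈ C, ∃ t ≥ 0, P (φ.toFun t y - φ.toFun t k) (φ.toFun t y - φ.toFun t k) < 0) :
    ∃ T ≥ 0, ∀ t ≥ T, ∀ k ∈ C,
      P (φ.toFun t y - φ.toFun t k) (φ.toFun t y - φ.toFun t k) < 0 := by
  choose! t ht0 ht using h
  have hτ := hH3.2.1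
  obtain ⟨F, hF, hcov⟩ := hC.elim_nhds_subcover
    (fun k => {x | P (φ.toFun (t k) y - φ.toFun (t k) x) (φ.toFun (t k) y - φ.toFun (t k) x) < 0})
    (fun k hk => by
      have hc := sf_cont φ (ht0 k hk)
      exact (isOpen_lt (f := fun x => P (φ.toFun (t k) y - φ.toFun (t k) x)
        (φ.toFun (t k) y - φ.toFun (t k) x)) (by fun_prop) continuous_const).mem_nhds (ht k hk))
  refine ⟨∑ k ∈ F, t k + τV, by
    have := Finset.sum_nonneg (fun k hk => ht0 k (hF k hk)); linarith, fun s hs k hk => ?_⟩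
  have hk' := hcov hk
  simp only [mem_iUnion] at hk'
  obtain ⟨i, hi, hneg⟩ := hk'
  have := Finset.single_le_sum (f := t) (fun k hk => ht0 k (hF k hk)) hi
  exact dich_neg ι φ P δ τV ν hH3 y k (ht0 i (hF i hi)) (by linarith) hneg

end final


/-- **Poincaré–Bendixson trichotomy** (Theorem 1): under (H1), (H2) with `j = 2`, (H3),
(COM) and (S), the ω-limit set of any point with bounded positive semi-orbit is either
a stationary point, a periodic orbit, or a union of a nonempty set `N` of stationary
points and complete orbits whose α- and ω-limit sets lie in `N`. -/
theorem omegaLimit_trichotomy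
    {E : Type*} [NormedAddCommGroup E] [NormedSpace ℝ E]
    {H : Type*} [NormedAddCommGroup H] [InnerProductSpace ℝ H]
    (ι : E →L[ℝ] H) (hι : Function.Injective ι)
    (φ : Semiflow E)
    (P : E →L[ℝ] E →L[ℝ] ℝ) (Eplus Eminus : Submodule ℝ E)
    (hH1 : Semiflow.IsH1 P Eplus Eminus)
    [FiniteDimensional ℝ ↥Eminus] (hH2 : Module.finrank ℝ ↥Eminus = 2)
    (δ τV ν : ℝ) (hH3 : φ.IsH3 ι P δ τV ν)
    (hCOM : φ.IsCOM) (hS : φ.IsSmoothing ι)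
    (w₀ : E) (hbdd : IsBounded (φ.orbit w₀)) :
    (∃ v₀ : E, φ.IsStationary v₀ ∧ φ.omegaLimit w₀ = {v₀}) ∨
    (∃ v₀ : E, φ.IsPeriodicPt v₀ ∧ φ.omegaLimit w₀ = φ.orbit v₀) ∨
    (∃ N : Set E, N.Nonempty ∧ (∀ p ∈ N, φ.IsStationary p) ∧
      ∃ T : Set (ℝ → E),
        (∀ v ∈ T, φ.IsCompleteTrajectory v ∧ φ.alphaLimitOf v ⊆ N ∧
          φ.omegaLimit (v 0) ⊆ N) ∧
        φ.omegaLimit w₀ = N ∪ ⋃ v ∈ T, Set.range v) := by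
  have hy : pbTail φ w₀ := by
    obtain ⟨τ, hτ, h⟩ := hCOM
    refine ⟨_, h _ hbdd, τ, hτ.le, fun t ht => subset_closure ?_⟩
    refine ⟨φ.toFun (t - τ) w₀, ⟨t - τ, by linarith, rfl⟩, ?_⟩
    rw [← φ.map_add' _ _ hτ.le (by linarith), add_sub_cancel]
  obtain ⟨Q, hQ⟩ := pb_proj P Eplus Eminus hH1 hH2
  have hsymm : ∀ a b : E, P (a - b) (a - b) = P (b - a) (b - a) := fun a b => by
    simp only [map_sub, sub_apply]; ring
  have hQ' : ∀ a b, P (a - b) (a - b) < 0 → Q a ≠ Q b := fun a b h he =>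
    hQ _ h (by rw [map_sub, he, sub_self])
  have hKc := om_compact φ hy
  have hU : pbUnique φ (φ.omegaLimit w₀) := pb_unique_of ι hι φ P δ τV ν hH3 hKc
  have hQK : ∀ a ∈ φ.omegaLimit w₀, ∀ b ∈ φ.omegaLimit w₀, Q a = Q b → a = b := by
    intro a ha b hb hab
    by_contra hne
    obtain ⟨u, hu, huK, rfl⟩ := om_ct φ hy ha
    obtain ⟨v, hv, hvK, rfl⟩ := om_ct φ hy hb
    exact hQ' _ _ (ct_neg ι hι φ P δ τV ν hH3 hKc hu hv huK hvK le_rfl hne) hab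
  by_cases hA : ∃ k ∈ φ.omegaLimit w₀, ∀ t ≥ 0,
      0 ≤ P (φ.toFun t w₀ - φ.toFun t k) (φ.toFun t w₀ - φ.toFun t k)
  · obtain ⟨k, hk, hV⟩ := hA
    have hsub := caseA_sub ι φ P δ τV ν hH3 hS w₀ k hy hV
    have hsub' : φ.omegaLimit k ⊆ φ.omegaLimit w₀ := by
      intro x hx
      obtain ⟨t, h1, -, h3⟩ := om_seq φ hx
      exact hKc.isClosed.mem_of_tendsto h3 (Eventually.of_forall fun n =>
        om_fwd φ hk ((Nat.cast_nonneg n).trans (h1 n)))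
    have heq : φ.omegaLimit w₀ = φ.omegaLimit k := subset_antisymm hsub hsub'
    have hyk : pbTail φ k := ⟨_, hKc, 0, le_rfl, fun t ht => om_fwd φ hk ht⟩
    by_cases hper : ∃ s > 0, φ.toFun s k = k
    · obtain ⟨s, hs, hsk⟩ := hper
      obtain ⟨q, hq, hq'⟩ := per_orbit ι φ P δ τV ν hH3 hS k hyk hs (by
        intro t ht; simp [hsk])
      rcases per_T12 φ hs hq (heq.trans hq') with h | h
      · exact Or.inl h
      · exact Or.inr (Or.inl h)
    · rw [heq] at hU hQK hk ⊢
      refine pb_main φ hyk Q hQK hU ?_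
      intro ε0 hε0
      refine ⟨0, le_rfl, fun t ht s hs he => hper ⟨s, by linarith, ?_⟩⟩
      have hs0 : 0 ≤ s := by linarith
      have h1 := hQK _ (om_fwd φ hk ht) _ (om_fwd φ hk (s := t + s) (by linarith)) he
      obtain ⟨v, hv, hvK, hv0⟩ := om_ct φ hyk hk
      have h2 : v t = v (t + s) := by
        have e1 := hv.2 t ht 0
        have e2 := hv.2 (t + s) (by linarith) 0
        rw [add_zero, hv0] at e1 e2
        rw [e1, e2, h1]
      have h3 := ct_meet hU hv hv hvK hvK h2 (-t)
      rw [neg_add_cancel, neg_add_cancel_left, hv0] at h3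
      have e2 := hv.2 s hs0 0
      rw [add_zero, hv0] at e2
      rw [← e2, ← h3]
  · push Not at hA
    by_cases hB : ∃ s > 0, ∀ t ≥ 0, 0 ≤ P (φ.toFun t (φ.toFun s w₀) - φ.toFun t w₀)
        (φ.toFun t (φ.toFun s w₀) - φ.toFun t w₀)
    · obtain ⟨s, hs, hV⟩ := hB
      obtain ⟨q, hq, hq'⟩ := per_orbit ι φ P δ τV ν hH3 hS w₀ hy hs hV
      rcases per_T12 φ hs hq hq' with h | h
      · exact Or.inl h
      · exact Or.inr (Or.inl h)
    push Not at hB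
    refine pb_main φ hy Q hQK hU ?_
    have hτ := hH3.2.1
    obtain ⟨T1, hT1, hneg⟩ := pb_unif ι φ P δ τV ν hH3 w₀ hKc hA
    have hneg' : φ.omegaLimit w₀ ⊆ {x | P (φ.toFun T1 w₀ - x) (φ.toFun T1 w₀ - x) < 0} := by
      intro k hk
      obtain ⟨k', hk', rfl⟩ := om_bwd φ hy hk hT1
      exact hneg T1 le_rfl k' hk'
    obtain ⟨S0, hS0, hS0'⟩ := om_nbhd φ hy (isOpen_lt
      (f := fun x => P (φ.toFun T1 w₀ - x) (φ.toFun T1 w₀ - x)) (by fun_prop)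
      continuous_const) hneg'
    intro ε0 hε0
    obtain ⟨T2, hT2, hneg2⟩ := pb_unif ι φ P δ τV ν hH3 w₀
      (C := (fun s => φ.toFun (max s 0) w₀) '' Icc ε0 S0)
      (isCompact_Icc.image (sf_path φ w₀)) (by
        rintro _ ⟨s, hs, rfl⟩
        obtain ⟨t, ht, h⟩ := hB s (by linarith [hs.1])
        refine ⟨t, ht, ?_⟩
        simp only
        rw [max_eq_left (by linarith [hs.1]), hsymm]
        exact h)
    refine ⟨T1 + τV + T2, by linarith, fun t ht s hs => hQ' _ _ ?_⟩
    rw [φ.map_add' t s (by linarith) (by linarith)]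
    rcases le_total s S0 with h | h
    · refine hneg2 t (by linarith) _ ⟨s, ⟨hs, h⟩, ?_⟩
      simp only
      rw [max_eq_left (by linarith)]
    · refine dich_neg ι φ P δ τV ν hH3 w₀ (φ.toFun s w₀) hT1 (by linarith) ?_
      rw [← φ.map_add' _ _ hT1 (by linarith)]
      exact hS0' (T1 + s) (by linarith)
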